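/- The metric space (Λ,d) underlying an ℝ-building (Λ,F) is a CAT(0) space: it is geodesic, and for all points x, y, z ∈ Λ, every point a lying on a geodesic from x to y, and all points x̄, ȳ, z̄ of the Euclidean plane ℝ² with ‖x̄−ȳ‖ = d(x,y), ‖ȳ−z̄‖ = d(y,z), ‖x̄−z̄‖ = d(x,z), letting ā be the point on the Euclidean segment [x̄,ȳ] with ‖x̄−ā‖ = d(x,a), one has d(z,a) ≤ ‖z̄−ā‖. -/

import Mathlib

open Set

noncomputable section

/-- The model space `𝔸`: Euclidean `n`-space. -/
abbrev ModelSpace (n : ℕ) : Type := EuclideanSpace ℝ (Fin n)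

/-- A linear reflection of the model space: an involutive isometry, different from the
identity, whose fixed-point set is a linear hyperplane (the kernel of a nonzero linear
functional). -/
def IsLinearReflection {n : ℕ} (s : ModelSpace n ≃ᵢ ModelSpace n) : Prop :=
  s * s = 1 ∧ s ≠ 1 ∧
    ∃ p : ModelSpace n →ₗ[ℝ] ℝ, p ≠ 0 ∧ {x | s x = x} = {x | p x = 0}

/-- A spherical Coxeter system of rank `n`, realized as a finite reflection group acting
on the model space `ℝⁿ`: a finite set `S` of linear reflections generating a finite
group `W̄`. -/
structure SphericalCoxeterSystem (n : ℕ) where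
  S : Set (ModelSpace n ≃ᵢ ModelSpace n)
  finiteS : S.Finite
  refl : ∀ s ∈ S, IsLinearReflection s
  finiteW : Finite ↥(Subgroup.closure S)

namespace SphericalCoxeterSystem

variable {n : ℕ}

/-- The finite reflection group `W̄` generated by `S`. -/
def Wbar (cs : SphericalCoxeterSystem n) : Subgroup (ModelSpace n ≃ᵢ ModelSpace n) :=
  Subgroup.closure cs.S

/-- A translation of the model space. -/
def IsTranslation (t : ModelSpace n ≃ᵢ ModelSpace n) : Prop :=
  ∃ v : ModelSpace n, ∀ x, t x = x + v

/-- The group `W` of affine transformations generated by `W̄` and all translations. -/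
def W (cs : SphericalCoxeterSystem n) : Subgroup (ModelSpace n ≃ᵢ ModelSpace n) :=
  Subgroup.closure (cs.S ∪ {t | IsTranslation t})

/-- An affine reflection: a `W`-conjugate of a generator in `S`. -/
def IsAffineReflection (cs : SphericalCoxeterSystem n)
    (r : ModelSpace n ≃ᵢ ModelSpace n) : Prop :=
  ∃ s ∈ cs.S, ∃ w ∈ cs.W, r = w * s * w⁻¹

/-- A wall of the model space: the fixed-point set of an affine reflection. -/
def IsModelWall (cs : SphericalCoxeterSystem n) (M : Set (ModelSpace n)) : Prop :=
  ∃ r, cs.IsAffineReflection r ∧ M = {x | r x = x}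

/-- A half-apartment of the model space: a closed half-space `H` bounded by the
wall `M` (fixed-point set of the affine reflection `r`). -/
def IsModelHalf (cs : SphericalCoxeterSystem n) (M H : Set (ModelSpace n)) : Prop :=
  ∃ r, cs.IsAffineReflection r ∧ M = {x | r x = x} ∧
    IsClosed H ∧ Convex ℝ H ∧ H ∪ (⇑r '' H) = univ ∧ H ∩ (⇑r '' H) = M

/-- A sector-face of the model space based at `x`: a closed cell of the arrangement of
all walls through `x` (for each wall through `x` one chooses either the wall itself or
one of its two half-apartments, and takes the intersection of the choices). -/
def IsModelSectorFace (cs : SphericalCoxeterSystem n) (x : ModelSpace n)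
    (F : Set (ModelSpace n)) : Prop :=
  F.Nonempty ∧ ∃ σ : Set (ModelSpace n) → Set (ModelSpace n),
    (∀ M, cs.IsModelWall M → x ∈ M → (σ M = M ∨ cs.IsModelHalf M (σ M))) ∧
    F = ⋂ M ∈ {M | cs.IsModelWall M ∧ x ∈ M}, σ M

/-- A sector of the model space based at `x`: a maximal sector-face based at `x`. -/
def IsModelSector (cs : SphericalCoxeterSystem n) (x : ModelSpace n)
    (F : Set (ModelSpace n)) : Prop :=
  cs.IsModelSectorFace x F ∧ ∀ F', cs.IsModelSectorFace x F' → F ⊆ F' → F' = F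

/-- A sector-panel of the model space based at `x`: a sector-face of codimension one. -/
def IsModelSectorPanel (cs : SphericalCoxeterSystem n) (x : ModelSpace n)
    (F : Set (ModelSpace n)) : Prop :=
  cs.IsModelSectorFace x F ∧ Module.finrank ℝ (affineSpan ℝ F).direction = n - 1

/-- The word length on `W̄` with respect to the generating set `S`. -/
def wordLength (cs : SphericalCoxeterSystem n) (w : ModelSpace n ≃ᵢ ModelSpace n) : ℕ :=
  sInf {k | ∃ l : List (ModelSpace n ≃ᵢ ModelSpace n),
    l.length = k ∧ (∀ s ∈ l, s ∈ cs.S) ∧ l.prod = w}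

/-- The longest element of `W̄`. -/
def IsLongest (cs : SphericalCoxeterSystem n) (w : ModelSpace n ≃ᵢ ModelSpace n) : Prop :=
  w ∈ cs.Wbar ∧ ∀ v ∈ cs.Wbar, cs.wordLength v ≤ cs.wordLength w

end SphericalCoxeterSystem

section Building

variable {n : ℕ} {X : Type*} [MetricSpace X]

/-- Two subsets of a metric space are parallel if their Hausdorff distance is finite. -/
def Par (S T : Set X) : Prop := EMetric.hausdorffEdist S T ≠ ⊤

/-- Two sets locally coincide at `α` (have the same germ at `α`) if their intersection
is a neighbourhood of `α` in both of them. -/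
def LocCoin (α : X) (F F' : Set X) : Prop :=
  F ∩ F' ∈ nhdsWithin α F ∧ F ∩ F' ∈ nhdsWithin α F'

variable (cs : SphericalCoxeterSystem n)

/-- An apartment: the image of a chart. -/
def IsApartment (Fc : Set (ModelSpace n → X)) (A : Set X) : Prop :=
  ∃ f ∈ Fc, A = range f

/-- A sector-face based at `α` : the image under a chart of a sector-face of the model
space, with base point mapped to `α`. -/
def IsSectorFaceAt (Fc : Set (ModelSpace n → X)) (α : X) (F : Set X) : Prop :=
  ∃ f ∈ Fc, ∃ x s, cs.IsModelSectorFace x s ∧ f x = α ∧ F = f '' s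

/-- A sector based at `α`. -/
def IsSectorAt (Fc : Set (ModelSpace n → X)) (α : X) (F : Set X) : Prop :=
  ∃ f ∈ Fc, ∃ x s, cs.IsModelSector x s ∧ f x = α ∧ F = f '' s

/-- A sector-panel based at `α`. -/
def IsSectorPanelAt (Fc : Set (ModelSpace n → X)) (α : X) (F : Set X) : Prop :=
  ∃ f ∈ Fc, ∃ x s, cs.IsModelSectorPanel x s ∧ f x = α ∧ F = f '' s

/-- A sector-face. -/
def IsSectorFace (Fc : Set (ModelSpace n → X)) (F : Set X) : Prop :=
  ∃ α, IsSectorFaceAt cs Fc α F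

/-- A sector. -/
def IsSector (Fc : Set (ModelSpace n → X)) (F : Set X) : Prop :=
  ∃ α, IsSectorAt cs Fc α F

/-- A sector-panel. -/
def IsSectorPanel (Fc : Set (ModelSpace n → X)) (F : Set X) : Prop :=
  ∃ α, IsSectorPanelAt cs Fc α F

/-- A wall: the image of a wall of the model space under a chart. -/
def IsWall (Fc : Set (ModelSpace n → X)) (M : Set X) : Prop :=
  ∃ f ∈ Fc, ∃ m, cs.IsModelWall m ∧ M = f '' m

/-- A half-apartment: the image of a half-apartment of the model space under a chart. -/
def IsHalfApartment (Fc : Set (ModelSpace n → X)) (H : Set X) : Prop :=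
  ∃ f ∈ Fc, ∃ m h, cs.IsModelHalf m h ∧ H = f '' h

/-- An ℝ-building of type `(W̄,S)` with set of points `Λ` inside the ambient metric
space `X` (taking `Λ` a subset of an ambient metric space makes it possible to speak of
one ℝ-building being contained in another): a set of isometric charts from the model
space satisfying the axioms (A1)–(A5). -/
structure RBuilding (cs : SphericalCoxeterSystem n) (X : Type*) [MetricSpace X]
    (Λ : Set X) : Type _ where
  charts : Set (ModelSpace n → X)
  isom : ∀ f ∈ charts, Isometry f
  into : ∀ f ∈ charts, range f ⊆ Λ
  A1 : ∀ f ∈ charts, ∀ w ∈ cs.W, (f ∘ ⇑w) ∈ charts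
  A2 : ∀ f ∈ charts, ∀ g ∈ charts,
        IsClosed {x | f x ∈ range g} ∧ Convex ℝ {x | f x ∈ range g} ∧
        ∃ w ∈ cs.W, ∀ x, f x ∈ range g → f x = g (w x)
  A3 : ∀ p ∈ Λ, ∀ q ∈ Λ, ∃ f ∈ charts, p ∈ range f ∧ q ∈ range f
  A4 : ∀ S₁ S₂, IsSector cs charts S₁ → IsSector cs charts S₂ →
        ∃ T₁ T₂ f, f ∈ charts ∧ IsSector cs charts T₁ ∧ IsSector cs charts T₂ ∧
          T₁ ⊆ S₁ ∧ T₂ ⊆ S₂ ∧ T₁ ⊆ range f ∧ T₂ ⊆ range f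
  A5 : ∀ f₁ ∈ charts, ∀ f₂ ∈ charts, ∀ f₃ ∈ charts,
        IsHalfApartment cs charts (range f₁ ∩ range f₂) →
        IsHalfApartment cs charts (range f₂ ∩ range f₃) →
        IsHalfApartment cs charts (range f₁ ∩ range f₃) →
        (range f₁ ∩ range f₂ ∩ range f₃).Nonempty

/-- The Weyl distance, inside the apartment given by the chart `f`, from the sector `S`
to the sector `S'` (both contained in that apartment): the element `w ∈ W̄` mapping the
sector of the model space based at the origin parallel to `f⁻¹(S)` to the one parallel
to `f⁻¹(S')`. -/
def WeylDistIn (f : ModelSpace n → X) (S S' : Set X)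
    (w : ModelSpace n ≃ᵢ ModelSpace n) : Prop :=
  w ∈ cs.Wbar ∧ ∃ s s', cs.IsModelSector 0 s ∧ cs.IsModelSector 0 s' ∧
    Par (f '' s) S ∧ Par (f '' s') S' ∧ ⇑w '' s = s'

/-- `w` is the Weyl distance from the germ at `α` of the sector `S` to the germ at `α`
of the sector `S'` (both based at `α`): computed via sectors based at `α` with the same
germs lying in a common apartment. -/
def GermWeylDist (Fc : Set (ModelSpace n → X)) (α : X) (S S' : Set X)
    (w : ModelSpace n ≃ᵢ ModelSpace n) : Prop :=
  ∃ f ∈ Fc, ∃ T T', IsSectorAt cs Fc α T ∧ IsSectorAt cs Fc α T' ∧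
    T ⊆ range f ∧ T' ⊆ range f ∧ LocCoin α S T ∧ LocCoin α S' T' ∧
    WeylDistIn cs f T T' w

/-- `w` is the Weyl distance between the chambers at infinity represented by the
sectors `S` and `S'`: computed via parallel sectors lying in a common apartment. -/
def ChamberWeylDist (Fc : Set (ModelSpace n → X)) (S S' : Set X)
    (w : ModelSpace n ≃ᵢ ModelSpace n) : Prop :=
  ∃ f ∈ Fc, ∃ T T', IsSector cs Fc T ∧ IsSector cs Fc T' ∧
    T ⊆ range f ∧ T' ⊆ range f ∧ Par T S ∧ Par T' S' ∧ WeylDistIn cs f T T' w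

/-- The germs at `α` of two sectors based at `α` are opposite if their Weyl distance is
the longest element of `W̄`. -/
def OppositeGerms (Fc : Set (ModelSpace n → X)) (α : X) (S S' : Set X) : Prop :=
  ∃ w, GermWeylDist cs Fc α S S' w ∧ cs.IsLongest w

/-- Two chambers at infinity (represented by the sectors `C`, `D`) are adjacent if they
are distinct and their Weyl distance lies in `S`. -/
def AdjacentChambers (Fc : Set (ModelSpace n → X)) (C D : Set X) : Prop :=
  ¬ Par C D ∧ ∃ s ∈ cs.S, ChamberWeylDist cs Fc C D s

/-- Two sector-panels are asymptotic if they contain a common subset which is itself a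
sector-panel. -/
def Asymptotic (Fc : Set (ModelSpace n → X)) (P P' : Set X) : Prop :=
  ∃ Q, IsSectorPanel cs Fc Q ∧ Q ⊆ P ∧ Q ⊆ P'

/-- An automorphism of an ℝ-building: an isometry `g` of `Λ` with `g ∘ f` a chart for
every chart `f`. -/
def RBuilding.IsAuto {Λ : Set X} (B : RBuilding cs X Λ) (g : ↥Λ ≃ᵢ ↥Λ) : Prop :=
  ∀ f (hf : f ∈ B.charts),
    (fun a : ModelSpace n =>
      ((g ⟨f a, B.into f hf (mem_range_self a)⟩ : ↥Λ) : X)) ∈ B.charts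

end Building

section CAT0

/-- `G` is a geodesic segment from `x` to `y`: an isometric image of a closed real
interval with endpoints `x` and `y`. -/
def IsGeodesicSegment {Y : Type*} [MetricSpace Y] (x y : Y) (G : Set Y) : Prop :=
  ∃ (a b : ℝ) (γ : ℝ → Y), a ≤ b ∧ γ a = x ∧ γ b = y ∧
    (∀ s ∈ Set.Icc a b, ∀ t ∈ Set.Icc a b, dist (γ s) (γ t) = |s - t|) ∧
    G = γ '' Set.Icc a b

/-- A CAT(0) space: a geodesic metric space in which every geodesic triangle satisfies
the CAT(0) comparison inequality with respect to comparison triangles in the Euclidean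
plane. -/
def IsCAT0Space (Y : Type*) [MetricSpace Y] : Prop :=
  (∀ x y : Y, ∃ G, IsGeodesicSegment x y G) ∧
  ∀ (x y z : Y) (G : Set Y), IsGeodesicSegment x y G → ∀ a ∈ G,
    ∀ x' y' z' : EuclideanSpace ℝ (Fin 2),
      dist x' y' = dist x y → dist y' z' = dist y z → dist x' z' = dist x z →
      ∀ a' ∈ segment ℝ x' y', dist x' a' = dist x a → dist z a ≤ dist z' a'

end CAT0

namespace WeylAtlas

open Filter Topology
open scoped InnerProductSpace

section General

variable {E : Type*} [NormedAddCommGroup E] [InnerProductSpace ℝ E]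

/-- If finitely many closed convex sets cover a vector space, one of them contains an initial
piece of a given segment. -/
theorem exists_initial_segment_mem {𝒦 : Set (Set E)} (hfin : 𝒦.Finite)
    (hcl : ∀ K ∈ 𝒦, IsClosed K) (hconv : ∀ K ∈ 𝒦, Convex ℝ K) (hcov : ∀ x, ∃ K ∈ 𝒦, x ∈ K)
    (a d : E) : ∃ K ∈ 𝒦, ∃ s : ℝ, 0 < s ∧ ∀ t ∈ Icc 0 s, a + t • d ∈ K := by
  have hfreq : ∃ K ∈ 𝒦, ∃ᶠ t in 𝓝[>] (0 : ℝ), a + t • d ∈ K := by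
    by_contra! h
    have h' : ∀ᶠ t in 𝓝[>] (0 : ℝ), ∀ K ∈ 𝒦, a + t • d ∉ K :=
      (eventually_all_finite hfin).2 fun K hK => by simpa using h K hK
    obtain ⟨t, ht⟩ := h'.exists
    obtain ⟨K, hK, htK⟩ := hcov (a + t • d)
    exact ht K hK htK
  obtain ⟨K, hK, hf⟩ := hfreq
  have hcont : Continuous fun t : ℝ => a + t • d := by fun_prop
  have ha : a ∈ K := by
    have htend : Tendsto (fun t : ℝ => a + t • d) (𝓝[>] 0) (𝓝 a) := by
      have := (hcont.tendsto 0).mono_left (nhdsWithin_le_nhds (s := Ioi 0))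
      simpa using this
    exact (hcl K hK).mem_of_frequently_of_tendsto hf htend
  obtain ⟨s, hsK, hs⟩ := (hf.and_eventually self_mem_nhdsWithin).exists
  have hs : 0 < s := hs
  refine ⟨K, hK, s, hs, fun t ht => ?_⟩
  have := hconv K hK ha hsK (a := 1 - t / s) (b := t / s)
    (by rw [sub_nonneg, div_le_one hs]; exact ht.2) (div_nonneg ht.1 hs.le) (by ring)
  convert this using 1
  have : t • d = (t / s) • s • d := by rw [smul_smul, div_mul_cancel₀ _ hs.ne']
  rw [this]
  module

/-- A map which is `1`-Lipschitz on each member of a finite closed convex cover is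
`1`-Lipschitz. -/
theorem norm_sub_le_of_cover {𝒦 : Set (Set E)} (hfin : 𝒦.Finite)
    (hcl : ∀ K ∈ 𝒦, IsClosed K) (hconv : ∀ K ∈ 𝒦, Convex ℝ K) (hcov : ∀ x, ∃ K ∈ 𝒦, x ∈ K)
    {r : E → E} (hr : ∀ K ∈ 𝒦, ∀ x ∈ K, ∀ y ∈ K, ‖r x - r y‖ ≤ ‖x - y‖) (a b : E) :
    ‖r a - r b‖ ≤ ‖a - b‖ := by
  have hcont : Continuous r := by
    have : Finite 𝒦 := hfin
    refine LocallyFinite.continuous (f := fun K : 𝒦 => (K : Set E)) (locallyFinite_of_finite _) ?_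
      (fun K => hcl K K.2) fun K => ?_
    · ext x; obtain ⟨K, hK, hx⟩ := hcov x; simpa using ⟨K, hK, hx⟩
    · refine LipschitzOnWith.continuousOn (K := 1) (LipschitzOnWith.of_dist_le_mul ?_)
      intro x hx y hy
      simpa [dist_eq_norm] using hr K K.2 x hx y hy
  set d := b - a with hd
  have hline : Continuous fun t : ℝ => r (a + t • d) := hcont.comp (by fun_prop)
  have key : Icc (0 : ℝ) 1 ⊆ {t | ‖r (a + t • d) - r a‖ ≤ t * ‖d‖} := by
    refine IsClosed.Icc_subset_of_forall_exists_gt ?_ (by simp) ?_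
    · exact (isClosed_le (by fun_prop) (by fun_prop)).inter isClosed_Icc
    · rintro x ⟨hx, hx01⟩ y hy
      obtain ⟨K, hK, s, hs, hseg⟩ :=
        exists_initial_segment_mem hfin hcl hconv hcov (a + x • d) d
      have hy : x < y := hy
      refine ⟨x + min s (y - x), ?_, ?_, ?_⟩
      · have hm : 0 < min s (y - x) := lt_min hs (by linarith)
        have h1 := hr K hK _ (hseg (min s (y - x)) ⟨hm.le, min_le_left _ _⟩) _
          (hseg 0 ⟨le_rfl, hs.le⟩)
        simp only [zero_smul, add_zero, add_sub_cancel_left, norm_smul, Real.norm_eq_abs,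
          abs_of_pos hm] at h1
        have h2 : a + (x + min s (y - x)) • d = a + x • d + min s (y - x) • d := by module
        simp only [mem_ofPred_eq] at hx ⊢
        rw [h2]
        calc _ ≤ ‖r (a + x • d + min s (y - x) • d) - r (a + x • d)‖
              + ‖r (a + x • d) - r a‖ := norm_sub_le_norm_sub_add_norm_sub _ _ _
          _ ≤ _ := by linarith
      · have := lt_min hs (sub_pos.2 hy); linarith
      · have := min_le_right s (y - x); linarith
  have := key (right_mem_Icc.2 zero_le_one)
  simp only [mem_ofPred_eq, one_smul, one_mul, hd, add_sub_cancel] at this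
  rwa [norm_sub_rev, norm_sub_rev a b]

/-- The closed Weyl chamber containing `u` of the arrangement of hyperplanes orthogonal
to the vectors in `Φ`. -/
def chamber (Φ : Set E) (u : E) : Set E := {x | ∀ α ∈ Φ, 0 < ⟪α, u⟫_ℝ → 0 ≤ ⟪α, x⟫_ℝ}

theorem eq_of_norm_sub_le {x y w : E} {s t : ℝ} (hs : 0 ≤ s) (ht : 0 ≤ t) (hst : s + t = 1)
    (hx : ‖x - w‖ ≤ ‖x - (s • x + t • y)‖) (hy : ‖y - w‖ ≤ ‖y - (s • x + t • y)‖) :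
    w = s • x + t • y := by
  obtain rfl : s = 1 - t := by linarith
  have e₁ : x - ((1 - t) • x + t • y) = t • (x - y) := by module
  have e₂ : y - ((1 - t) • x + t • y) = -((1 - t) • (x - y)) := by module
  have e₃ : w - ((1 - t) • x + t • y) = -((1 - t) • (x - w) + t • (y - w)) := by module
  have e₄ : x - y = (x - w) - (y - w) := by abel
  rw [e₁, norm_smul, Real.norm_of_nonneg ht] at hx
  rw [e₂, norm_neg, norm_smul, Real.norm_of_nonneg hs] at hy
  rw [← sub_eq_zero, ← norm_eq_zero, ← sq_eq_zero_iff, e₃, norm_neg, norm_add_sq_real]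
  have hx2 := pow_le_pow_left₀ (norm_nonneg _) hx 2
  have hy2 := pow_le_pow_left₀ (norm_nonneg _) hy 2
  have hn : ‖x - y‖ ^ 2 = ‖x - w‖ ^ 2 - 2 * ⟪x - w, y - w⟫_ℝ + ‖y - w‖ ^ 2 := by
    rw [e₄, norm_sub_sq_real]
  rw [mul_pow, hn] at hx2 hy2
  rw [norm_smul, norm_smul, inner_smul_left, inner_smul_right, Real.norm_of_nonneg ht,
    Real.norm_of_nonneg hs]
  simp only [conj_trivial]
  apply le_antisymm _
  · have := norm_add_sq_real ((1 - t) • (x - w)) (t • (y - w))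
    rw [norm_smul, norm_smul, inner_smul_left, inner_smul_right, Real.norm_of_nonneg ht,
      Real.norm_of_nonneg hs] at this
    simp only [conj_trivial] at this
    rw [← this]; positivity
  · nlinarith [mul_le_mul_of_nonneg_left hx2 hs, mul_le_mul_of_nonneg_left hy2 ht]

variable {Φ : Set E} {u v x y : E}

theorem self_mem_chamber : u ∈ chamber Φ u := fun _ _ h => h.le

theorem zero_mem_chamber : (0 : E) ∈ chamber Φ u := fun _ _ _ => by simp

theorem add_mem_chamber (hx : x ∈ chamber Φ u) (hy : y ∈ chamber Φ u) : x + y ∈ chamber Φ u :=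
  fun α hα h => by rw [inner_add_right]; exact add_nonneg (hx α hα h) (hy α hα h)

theorem smul_mem_chamber {c : ℝ} (hc : 0 ≤ c) (hx : x ∈ chamber Φ u) : c • x ∈ chamber Φ u :=
  fun α hα h => by rw [inner_smul_right]; exact mul_nonneg hc (hx α hα h)

theorem convex_chamber : Convex ℝ (chamber Φ u) := fun _ hx _ hy _ _ ha hb _ =>
  add_mem_chamber (smul_mem_chamber ha hx) (smul_mem_chamber hb hy)

theorem isClosed_chamber : IsClosed (chamber Φ u) := by
  simp only [chamber, ofPred_forall]
  exact isClosed_iInter fun α => isClosed_iInter fun _ => isClosed_iInter fun _ =>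
    isClosed_le continuous_const (by fun_prop)

theorem finite_setOf_chamber (hΦ : Φ.Finite) : {K | ∃ u : E, K = chamber Φ u}.Finite := by
  refine ((hΦ.finite_subsets).image fun T => {x : E | ∀ α ∈ T, 0 ≤ ⟪α, x⟫_ℝ}).subset ?_
  rintro K ⟨u, rfl⟩
  refine ⟨{α ∈ Φ | 0 < ⟪α, u⟫_ℝ}, fun α h => h.1, ?_⟩
  ext x
  simp [chamber]

/-- A sufficiently large multiple of `m`, translated by `y`, lies on the nonnegative side of every
member of a finite family which is positive at `m`. -/
theorem exists_smul_add_nonneg (hΦ : Φ.Finite) (m y : E) :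
    ∃ N : ℝ, 0 ≤ N ∧ ∀ α ∈ Φ, 0 < ⟪α, m⟫_ℝ → 0 ≤ ⟪α, N • m + y⟫_ℝ := by
  have : ∀ᶠ N : ℝ in atTop, 0 ≤ N ∧ ∀ α ∈ Φ, 0 < ⟪α, m⟫_ℝ → 0 ≤ ⟪α, N • m + y⟫_ℝ := by
    refine (eventually_ge_atTop 0).and ((eventually_all_finite hΦ).2 fun α _ => ?_)
    by_cases h : 0 < ⟪α, m⟫_ℝ
    · have := (tendsto_id.atTop_mul_const h).atTop_add (tendsto_const_nhds (x := ⟪α, y⟫_ℝ))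
      filter_upwards [this.eventually_ge_atTop 0] with N hN _
      simpa [inner_add_right, inner_smul_right] using hN
    · exact Eventually.of_forall fun N h' => absurd h' h
  exact this.exists

theorem exists_smul_add_mem_chamber (hΦ : Φ.Finite) (u y : E) :
    ∃ N : ℝ, 0 ≤ N ∧ N • u + y ∈ chamber Φ u := exists_smul_add_nonneg hΦ u y

/-- A vector is generic if only the identity in `G` fixes it. -/
def Generic (G : Subgroup (E ≃ₗᵢ[ℝ] E)) (u : E) : Prop := ∀ L ∈ G, L u = u → L = 1

variable {G : Subgroup (E ≃ₗᵢ[ℝ] E)}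

theorem Generic.map {L : E ≃ₗᵢ[ℝ] E} (hL : L ∈ G) (hu : Generic G u) : Generic G (L u) := by
  intro M hM h
  have := hu (L⁻¹ * M * L) (G.mul_mem (G.mul_mem (G.inv_mem hL) hM) hL) (by
    change L.symm (M (L u)) = u
    rw [h, LinearIsometryEquiv.symm_apply_apply])
  calc M = L * (L⁻¹ * M * L) * L⁻¹ := by group
    _ = 1 := by rw [this]; group

theorem Generic.neg (hu : Generic G u) : Generic G (-u) := fun L hL h =>
  hu L hL (by simpa using h)

variable [CompleteSpace E]

theorem dense_generic (hG : (G : Set (E ≃ₗᵢ[ℝ] E)).Finite) : Dense {u | Generic G u} := by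
  have : {u | Generic G u} = ⋂ L ∈ {L | L ∈ G ∧ L ≠ 1}, {u : E | L u ≠ u} := by
    ext u
    simp only [mem_ofPred_eq, mem_iInter, Generic]
    exact ⟨fun h L hL h' => hL.2 (h L hL.1 h'), fun h L hL h' => by
      by_contra h1; exact h L ⟨hL, h1⟩ h'⟩
  rw [this]
  refine dense_biInter_of_isOpen (fun L _ => ?_) (hG.subset fun L h => h.1).countable ?_
  · exact isOpen_ne_fun L.continuous continuous_id
  · rintro L ⟨_, hL⟩
    have : {u : E | L u ≠ u} = ((LinearMap.eqLocus L.toLinearEquiv.toLinearMap LinearMap.id :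
        Submodule ℝ E) : Set E)ᶜ := by ext u; simp
    rw [this, ← interior_eq_empty_iff_dense_compl, ← not_nonempty_iff_eq_empty]
    intro h
    have h := Submodule.eq_top_of_nonempty_interior' _ h
    apply hL
    ext x
    have : x ∈ (LinearMap.eqLocus L.toLinearEquiv.toLinearMap LinearMap.id : Submodule ℝ E) := by
      rw [h]; trivial
    simpa using this

theorem dense_inner_ne_zero {A : Set E} (hA : A.Finite) (h0 : ∀ α ∈ A, α ≠ 0) :
    Dense {u : E | ∀ α ∈ A, ⟪α, u⟫_ℝ ≠ 0} := by
  have : {u : E | ∀ α ∈ A, ⟪α, u⟫_ℝ ≠ 0} = ⋂ α ∈ A, {u : E | ⟪α, u⟫_ℝ ≠ 0} := by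
    ext u; simp
  rw [this]
  refine dense_biInter_of_isOpen (fun α _ => ?_) hA.countable fun α hα => ?_
  · exact isOpen_ne_fun (by fun_prop) continuous_const
  · have : {u : E | ⟪α, u⟫_ℝ ≠ 0} = ((LinearMap.ker (innerSL ℝ α).toLinearMap :
        Submodule ℝ E) : Set E)ᶜ := by ext u; simp
    rw [this, ← interior_eq_empty_iff_dense_compl, ← not_nonempty_iff_eq_empty]
    intro h
    have h := Submodule.eq_top_of_nonempty_interior' _ h
    apply h0 α hα
    have : α ∈ (LinearMap.ker (innerSL ℝ α).toLinearMap : Submodule ℝ E) := by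
      rw [h]; trivial
    simpa using this

/-- Every nonempty open set contains a generic vector; in particular there are generic vectors
whose closed chamber contains a given vector. -/
theorem exists_generic_mem_chamber (hG : (G : Set (E ≃ₗᵢ[ℝ] E)).Finite) (hΦ : Φ.Finite)
    (hneg : ∀ α ∈ Φ, -α ∈ Φ) (x : E) :
    ∃ u, Generic G u ∧ x ∈ chamber Φ u ∧ ∀ α ∈ Φ, 0 < ⟪α, x⟫_ℝ → 0 < ⟪α, u⟫_ℝ := by
  have ho : IsOpen (⋂ α ∈ {α ∈ Φ | 0 < ⟪α, x⟫_ℝ}, {u : E | 0 < ⟪α, u⟫_ℝ}) :=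
    (hΦ.subset fun α h => h.1).isOpen_biInter fun α _ =>
      isOpen_lt continuous_const (by fun_prop)
  obtain ⟨u, hu, hgen⟩ := (dense_generic hG).inter_open_nonempty _ ho
    ⟨x, by simp⟩
  simp only [mem_iInter, mem_ofPred_eq] at hu
  refine ⟨u, hgen, fun α hα h => ?_, fun α hα h => hu α ⟨hα, h⟩⟩
  by_contra! hlt
  have := hu (-α) ⟨hneg α hα, by simpa using hlt⟩
  simp only [inner_neg_left] at this
  linarith

end General
end WeylAtlas

open scoped InnerProductSpace in
/-- A family of isometric charts from a Euclidean space, with transition functions in the group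
generated by the translations and a finite linear group, in which any two Weyl chambers have
subchambers in a common chart, and such that three charts pairwise meeting in half-spaces have a
common point. -/
structure WeylAtlas (E X : Type*) [NormedAddCommGroup E] [InnerProductSpace ℝ E]
    [MetricSpace X] where
  charts : Set (E → X)
  group : Subgroup (E ≃ₗᵢ[ℝ] E)
  roots : Set E
  isometry : ∀ f ∈ charts, Isometry f
  finite_group : (group : Set (E ≃ₗᵢ[ℝ] E)).Finite
  finite_roots : roots.Finite
  norm_root : ∀ α ∈ roots, ‖α‖ = 1
  neg_root : ∀ α ∈ roots, -α ∈ roots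
  refl_mem : ∀ α ∈ roots, ∃ L ∈ group, ∀ x, L x = x - (2 * ⟪α, x⟫_ℝ) • α
  comp_mem : ∀ f ∈ charts, ∀ L ∈ group, (fun x => f (L x)) ∈ charts
  isClosed_preimage : ∀ f ∈ charts, ∀ g ∈ charts, IsClosed {x | f x ∈ range g}
  convex_preimage : ∀ f ∈ charts, ∀ g ∈ charts, Convex ℝ {x | f x ∈ range g}
  exists_transition : ∀ f ∈ charts, ∀ g ∈ charts, ∃ L ∈ group, ∃ τ,
    ∀ x, f x ∈ range g → f x = g (L x + τ)
  exists_common_chart : ∀ f ∈ charts, ∀ g ∈ charts, ∀ u v,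
    (∀ α ∈ roots, ⟪α, u⟫_ℝ ≠ 0) → (∀ α ∈ roots, ⟪α, v⟫_ℝ ≠ 0) →
    ∃ h ∈ charts, ∃ L ∈ group, ∃ p p' q q',
      (∀ x ∈ WeylAtlas.chamber roots u, f (p + x) = h (p' + x)) ∧
      (∀ x ∈ WeylAtlas.chamber roots v, g (q + x) = h (q' + L x))
  inter_nonempty : ∀ f₁ ∈ charts, ∀ f₂ ∈ charts, ∀ f₃ ∈ charts,
    (∃ f ∈ charts, ∃ α ∈ roots, ∃ c : ℝ, range f₁ ∩ range f₂ = f '' {x | c ≤ ⟪α, x⟫_ℝ}) →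
    (∃ f ∈ charts, ∃ α ∈ roots, ∃ c : ℝ, range f₂ ∩ range f₃ = f '' {x | c ≤ ⟪α, x⟫_ℝ}) →
    (∃ f ∈ charts, ∃ α ∈ roots, ∃ c : ℝ, range f₁ ∩ range f₃ = f '' {x | c ≤ ⟪α, x⟫_ℝ}) →
    (range f₁ ∩ range f₂ ∩ range f₃).Nonempty

namespace WeylAtlas

open Filter Topology
open scoped InnerProductSpace

section Asymptotic

variable {E X : Type*} [NormedAddCommGroup E] [InnerProductSpace ℝ E] [MetricSpace X]
  {f g h k : E → X} {u v w x y z : E} {a b c : ℝ}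

/-- The images under `f` and `g` of the rays in direction `u` and `v` diverge at speed at most
`c`. -/
def DivergeLE (f : E → X) (u : E) (g : E → X) (v : E) (c : ℝ) : Prop :=
  ∃ K, ∀ T : ℝ, 0 ≤ T → dist (f (T • u)) (g (T • v)) ≤ c * T + K

/-- The images under `f` and `g` of the rays in direction `u` and `v` are asymptotic. -/
def Asymp (f : E → X) (u : E) (g : E → X) (v : E) : Prop := DivergeLE f u g v 0

theorem DivergeLE.symm (hd : DivergeLE f u g v c) : DivergeLE g v f u c := by
  obtain ⟨K, hK⟩ := hd
  exact ⟨K, fun T hT => by rw [dist_comm]; exact hK T hT⟩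

theorem DivergeLE.trans (h₁ : DivergeLE f u g v a) (h₂ : DivergeLE g v h w b) :
    DivergeLE f u h w (a + b) := by
  obtain ⟨K, hK⟩ := h₁
  obtain ⟨K', hK'⟩ := h₂
  refine ⟨K + K', fun T hT => ?_⟩
  have := dist_triangle (f (T • u)) (g (T • v)) (h (T • w))
  linarith [hK T hT, hK' T hT]

theorem Asymp.symm (ha : Asymp f u g v) : Asymp g v f u := DivergeLE.symm ha

theorem Asymp.trans (h₁ : Asymp f u g v) (h₂ : Asymp g v h w) : Asymp f u h w := by
  simpa [Asymp] using DivergeLE.trans h₁ h₂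

theorem DivergeLE.congr (hd : DivergeLE f u g v c) (h₁ : Asymp f u h w) (h₂ : Asymp g v k x) :
    DivergeLE h w k x c := by
  simpa using (DivergeLE.trans h₁.symm hd).trans h₂

theorem Asymp.refl : Asymp f u f u := ⟨0, fun T _ => by simp⟩

theorem divergeLE_self (hf : Isometry f) (u v : E) : DivergeLE f u f v ‖u - v‖ :=
  ⟨0, fun T hT => by
    rw [hf.dist_eq, dist_eq_norm, ← smul_sub, norm_smul, Real.norm_of_nonneg hT]
    linarith [mul_comm T ‖u - v‖]⟩

theorem DivergeLE.norm_le (hf : Isometry f) (hd : DivergeLE f u f v c) : ‖u - v‖ ≤ c := by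
  obtain ⟨K, hK⟩ := hd
  by_contra! hlt
  have hT : 0 ≤ (|K| + 1) / (‖u - v‖ - c) := div_nonneg (by positivity) (sub_pos.2 hlt).le
  have := hK _ hT
  rw [hf.dist_eq, dist_eq_norm, ← smul_sub, norm_smul, Real.norm_of_nonneg hT] at this
  have h2 : (|K| + 1) / (‖u - v‖ - c) * (‖u - v‖ - c) = |K| + 1 :=
    div_mul_cancel₀ _ (sub_pos.2 hlt).ne'
  linarith [le_abs_self K]

theorem Asymp.eq (hf : Isometry f) (ha : Asymp f u f v) : u = v :=
  sub_eq_zero.1 (norm_le_zero_iff.1 (DivergeLE.norm_le hf ha))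

theorem asymp_of_eq {p q : E} (hf : Isometry f) (hg : Isometry g)
    (he : ∀ T : ℝ, 0 ≤ T → f (p + T • u) = g (q + T • v)) : Asymp f u g v := by
  refine ⟨‖p‖ + ‖q‖, fun T hT => ?_⟩
  have h₁ : dist (f (T • u)) (f (p + T • u)) = ‖p‖ := by simp [hf.dist_eq, dist_eq_norm]
  have h₂ : dist (g (q + T • v)) (g (T • v)) = ‖q‖ := by simp [hg.dist_eq, dist_eq_norm]
  have := dist_triangle (f (T • u)) (f (p + T • u)) (g (T • v))
  rw [he T hT, h₂, ← he T hT, h₁] at this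
  linarith

theorem Asymp.smul (ha : Asymp f u g v) (hc : 0 ≤ c) : Asymp f (c • u) g (c • v) := by
  obtain ⟨K, hK⟩ := ha
  exact ⟨K, fun T hT => by simpa [smul_smul] using hK (T * c) (mul_nonneg hT hc)⟩

end Asymptotic

section Atlas

variable {E X : Type*} [NormedAddCommGroup E] [InnerProductSpace ℝ E] [MetricSpace X]
  (A : WeylAtlas E X) {f g h k : E → X} {u v w x y z : E} {a b c : ℝ}

theorem regular_of_generic (hu : Generic A.group u) {α : E} (hα : α ∈ A.roots) :
    ⟪α, u⟫_ℝ ≠ 0 := by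
  intro h0
  obtain ⟨L, hL, hLx⟩ := A.refl_mem α hα
  have := hu L hL (by simp [hLx, h0])
  have h1 := hLx α
  have h2 := A.norm_root α hα
  rw [this, real_inner_self_eq_norm_sq, h2] at h1
  have : α = α - (2 : ℝ) • α := by simpa using h1
  have : (2 : ℝ) • α = 0 := sub_eq_self.1 this.symm
  have : α = 0 := by simpa using this
  simp [this] at h2

theorem exists_chart_asymp (hf : f ∈ A.charts) (hg : g ∈ A.charts) (hu : Generic A.group u)
    (hv : Generic A.group v) : ∃ h ∈ A.charts, ∃ L ∈ A.group,
      (∀ x ∈ chamber A.roots u, Asymp f x h x) ∧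
      (∀ x ∈ chamber A.roots v, Asymp g x h (L x)) := by
  obtain ⟨h, hh, L, hL, p, p', q, q', h₁, h₂⟩ := A.exists_common_chart f hf g hg u v
    (fun α hα => A.regular_of_generic hu hα) (fun α hα => A.regular_of_generic hv hα)
  refine ⟨h, hh, L, hL, fun x hx => ?_, fun x hx => ?_⟩
  · exact asymp_of_eq (A.isometry f hf) (A.isometry h hh)
      fun T hT => h₁ _ (smul_mem_chamber hT hx)
  · refine asymp_of_eq (p := q) (q := q') (A.isometry g hg) (A.isometry h hh) fun T hT => ?_
    rw [h₂ _ (smul_mem_chamber hT hx), map_smul]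

/-- Two charts with asymptotic rays in a generic direction share a subchamber in this
direction. -/
theorem exists_eq_of_asymp (hf : f ∈ A.charts) (hg : g ∈ A.charts) (hv : Generic A.group v)
    (ha : Asymp f v g v) : ∃ p q, ∀ x ∈ chamber A.roots v, f (p + x) = g (q + x) := by
  obtain ⟨h, hh, L, hL, p, p', q, q', h₁, h₂⟩ := A.exists_common_chart f hf g hg v v
    (fun α hα => A.regular_of_generic hv hα) (fun α hα => A.regular_of_generic hv hα)
  have e₁ : Asymp f v h v := asymp_of_eq (A.isometry f hf) (A.isometry h hh)
      fun T hT => h₁ _ (smul_mem_chamber hT self_mem_chamber)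
  have e₂ : Asymp g v h (L v) := by
    refine asymp_of_eq (p := q) (q := q') (A.isometry g hg) (A.isometry h hh) fun T hT => ?_
    rw [h₂ _ (smul_mem_chamber hT self_mem_chamber), map_smul]
  have hLv : L = 1 := hv L hL ((e₁.symm.trans (ha.trans e₂)).eq (A.isometry h hh)).symm
  obtain ⟨N, hN, hNv⟩ := exists_smul_add_mem_chamber A.finite_roots v (p' - q')
  refine ⟨p + N • v, q + (N • v + (p' - q')), fun x hx => ?_⟩
  rw [add_assoc, h₁ _ (add_mem_chamber (smul_mem_chamber hN self_mem_chamber) hx), add_assoc,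
    h₂ _ (add_mem_chamber hNv hx), hLv]
  congr 1
  simp only [LinearIsometryEquiv.coe_one, id_eq]
  abel

theorem asymp_of_mem_chamber (hf : f ∈ A.charts) (hg : g ∈ A.charts) (hv : Generic A.group v)
    (ha : Asymp f v g v) (hx : x ∈ chamber A.roots v) : Asymp f x g x := by
  obtain ⟨p, q, h⟩ := A.exists_eq_of_asymp hf hg hv ha
  exact asymp_of_eq (A.isometry f hf) (A.isometry g hg) fun T hT => h _ (smul_mem_chamber hT hx)

theorem eq_of_asymp_center (hf : f ∈ A.charts) (hg : g ∈ A.charts) (hu : Generic A.group u)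
    (ha : Asymp f u g u) (hxy : Asymp f x g y) : x = y := by
  have hle : ∀ c ∈ chamber A.roots u, ‖x - c‖ = ‖y - c‖ := by
    intro c hc
    have hcc := A.asymp_of_mem_chamber hf hg hu ha hc
    exact le_antisymm
      (((divergeLE_self (A.isometry g hg) y c).congr hxy.symm hcc.symm).norm_le (A.isometry f hf))
      (((divergeLE_self (A.isometry f hf) x c).congr hxy hcc).norm_le (A.isometry g hg))
  have hin : ∀ c ∈ chamber A.roots u, ⟪x - y, c⟫_ℝ = 0 := by
    intro c hc
    have h0 := hle 0 zero_mem_chamber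
    have h1 := congrArg (· ^ 2) (hle c hc)
    simp only [sub_zero] at h0
    simp only [norm_sub_sq_real, h0] at h1
    rw [inner_sub_left]
    linarith
  obtain ⟨N, hN, hNu⟩ := exists_smul_add_mem_chamber A.finite_roots u (x - y)
  have h1 := hin _ hNu
  rw [inner_add_right, inner_smul_right, hin u self_mem_chamber, mul_zero, zero_add] at h1
  exact sub_eq_zero.1 (inner_self_eq_zero.1 h1)

variable [CompleteSpace E]

/-- The retraction centred at the chamber of a generic direction does not increase the speed of
divergence. -/
theorem norm_sub_le_of_divergeLE (hf : f ∈ A.charts) (hg : g ∈ A.charts) (hh : h ∈ A.charts)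
    (hu : Generic A.group u) (hfg : Asymp f u g u) (hfh : Asymp f u h u)
    (hd : DivergeLE g x h y c) : ‖x - y‖ ≤ c := by
  have hex := exists_generic_mem_chamber A.finite_group A.finite_roots A.neg_root
  choose e he hmem _ using hex
  obtain ⟨k, hk, M, hM, h₁, h₂⟩ := A.exists_chart_asymp hg hh (he x) (he y)
  have hc : ‖x - M y‖ ≤ c := (hd.congr (h₁ x (hmem x)) (h₂ y (hmem y))).norm_le (A.isometry k hk)
  have hF : ∀ w, Generic A.group w → ∃ F ∈ A.charts, ∃ L ∈ A.group, Asymp f u F u ∧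
      ∀ z ∈ chamber A.roots w, Asymp k z F (L z) := fun w hw => by
    obtain ⟨F, hF, L, hL, h₁, h₂⟩ := A.exists_chart_asymp hf hk hu hw
    exact ⟨F, hF, L, hL, h₁ u self_mem_chamber, h₂⟩
  choose! F hF L hL hFu hFz using hF
  have huniq : ∀ F' ∈ A.charts, Asymp f u F' u → ∀ z z', Asymp k z F' z' → z' = L (e z) z :=
    fun F' hF' h' z z' hz => A.eq_of_asymp_center hF' (hF _ (he z)) hu
      (h'.symm.trans (hFu _ (he z))) (hz.symm.trans (hFz _ (he z) z (hmem z)))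
  have hfin : {K | ∃ w, Generic A.group w ∧ K = chamber A.roots w}.Finite :=
    (finite_setOf_chamber A.finite_roots).subset (by rintro K ⟨w, _, rfl⟩; exact ⟨w, rfl⟩)
  have hlip := norm_sub_le_of_cover (r := fun z => L (e z) z) hfin
    (by rintro K ⟨w, _, rfl⟩; exact isClosed_chamber)
    (by rintro K ⟨w, _, rfl⟩; exact convex_chamber)
    (fun z => ⟨_, ⟨e z, he z, rfl⟩, hmem z⟩)
    (by
      rintro K ⟨w, hw, rfl⟩ a ha b hb
      rw [← huniq _ (hF w hw) (hFu w hw) a _ (hFz w hw a ha),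
        ← huniq _ (hF w hw) (hFu w hw) b _ (hFz w hw b hb), ← map_sub,
        LinearIsometryEquiv.norm_map]) x (M y)
  rw [← huniq g hg hfg x x (h₁ x (hmem x)).symm,
    ← huniq h hh hfh (M y) y (h₂ y (hmem y)).symm] at hlip
  exact hlip.trans hc

/-- Asymptotic points of two charts form a convex set. -/
theorem convex_asymp (hf : f ∈ A.charts) (hg : g ∈ A.charts) :
    Convex ℝ {x | Asymp f x g x} := by
  intro x hx y hy s t hs ht hst
  set z := s • x + t • y with hz
  obtain ⟨e, he, hze, _⟩ :=
    exists_generic_mem_chamber A.finite_group A.finite_roots A.neg_root z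
  obtain ⟨h, hh, L, hL, h₁, h₂⟩ := A.exists_chart_asymp hf hg he he
  have key : ∀ a, Asymp f a g a → ‖a - L z‖ ≤ ‖a - z‖ := fun a ha =>
    A.norm_sub_le_of_divergeLE hf hf hh he Asymp.refl (h₁ e self_mem_chamber)
      ((divergeLE_self (A.isometry g hg) a z).congr ha.symm (h₂ z hze))
  have hLz : L z = z := eq_of_norm_sub_le hs ht hst (key x hx) (key y hy)
  have := h₂ z hze
  rw [hLz] at this
  exact (h₁ z hze).trans this.symm

theorem asymp_add (hf : f ∈ A.charts) (hg : g ∈ A.charts) (hx : Asymp f x g x)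
    (hy : Asymp f y g y) : Asymp f (x + y) g (x + y) := by
  have := Asymp.smul (c := 2) (A.convex_asymp hf hg hx hy (a := 1 / 2) (b := 1 / 2)
    (by norm_num) (by norm_num) (by norm_num)) (by norm_num)
  simpa [smul_smul] using this

end Atlas
end WeylAtlas

namespace WeylAtlas

open Filter Topology
open scoped InnerProductSpace

section Reflections

variable {E : Type*} [NormedAddCommGroup E] [InnerProductSpace ℝ E]

/-- A closed convex set containing a ray is stable under translations in the direction of the
ray. -/
theorem add_mem_of_ray {K : Set E} (hcl : IsClosed K) (hconv : Convex ℝ K) {p x y : E}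
    (hp : ∀ T : ℝ, 0 ≤ T → p + T • x ∈ K) (hy : y ∈ K) : y + x ∈ K := by
  have hcont : Continuous fun ε : ℝ => (1 - ε) • y + ε • p + x := by fun_prop
  have htend : Tendsto (fun ε : ℝ => (1 - ε) • y + ε • p + x) (𝓝[>] 0) (𝓝 (y + x)) := by
    have := (hcont.tendsto 0).mono_left (nhdsWithin_le_nhds (s := Ioi 0))
    simpa using this
  refine hcl.mem_of_tendsto htend ?_
  filter_upwards [Ioo_mem_nhdsGT (zero_lt_one (α := ℝ))] with ε hε
  have := hconv hy (hp ε⁻¹ (inv_nonneg.2 hε.1.le)) (a := 1 - ε) (b := ε)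
    (by linarith [hε.2]) hε.1.le (by ring)
  rwa [smul_add, smul_smul, mul_inv_cancel₀ hε.1.ne', one_smul, ← add_assoc] at this

theorem mem_of_forall_add_smul_mem {K : Set E} (hcl : IsClosed K) {x y : E}
    (h : ∀ ε : ℝ, 0 < ε → x + ε • y ∈ K) : x ∈ K := by
  have hcont : Continuous fun ε : ℝ => x + ε • y := by fun_prop
  have htend : Tendsto (fun ε : ℝ => x + ε • y) (𝓝[>] 0) (𝓝 x) := by
    have := (hcont.tendsto 0).mono_left (nhdsWithin_le_nhds (s := Ioi 0))
    simpa using this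
  exact hcl.mem_of_tendsto htend (by filter_upwards [self_mem_nhdsWithin] with ε hε using h ε hε)

theorem eq_one_or_eq_reflection (L : E ≃ₗᵢ[ℝ] E) {α : E} (hα : ‖α‖ = 1)
    (h : ∀ y, ⟪α, y⟫_ℝ = 0 → L y = y) :
    (∀ x, L x = x) ∨ ∀ x, L x = x - (2 * ⟪α, x⟫_ℝ) • α := by
  have hαα : ⟪α, α⟫_ℝ = 1 := by rw [real_inner_self_eq_norm_sq, hα]; norm_num
  set c := ⟪α, L α⟫_ℝ with hc
  have hy0 : ⟪α, L α - c • α⟫_ℝ = 0 := by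
    rw [inner_sub_right, inner_smul_right, hαα, ← hc]; ring
  have hy1 : ⟪L α, L α - c • α⟫_ℝ = 0 := by
    rw [← h _ hy0, LinearIsometryEquiv.inner_map_map, hy0]
  have hLα : L α = c • α := by
    rw [← sub_eq_zero, ← inner_self_eq_zero (𝕜 := ℝ), inner_sub_left, hy1, inner_smul_left, hy0]
    simp
  have hx : ∀ x, L x = x - ⟪α, x⟫_ℝ • α + (⟪α, x⟫_ℝ * c) • α := fun x => by
    have h1 := h (x - ⟪α, x⟫_ℝ • α)
      (by rw [inner_sub_right, inner_smul_right, hαα]; ring)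
    rw [map_sub, map_smul, hLα, smul_smul, sub_eq_iff_eq_add] at h1
    exact h1
  have hc1 : |c| = 1 := by
    have := L.norm_map α
    rwa [hLα, norm_smul, hα, mul_one, Real.norm_eq_abs] at this
  rcases eq_or_eq_neg_of_abs_eq hc1 with h1 | h1
  · left; intro x; rw [hx, h1]; simp
  · right; intro x; rw [hx, h1]; module

theorem range_inter_range_eq {Y Z : Type*} {f g : Y → Z} {p : Y → Prop}
    (h : ∀ y, f y ∈ range g ↔ p y) : range f ∩ range g = f '' {y | p y} := by
  ext x
  constructor
  · rintro ⟨⟨y, rfl⟩, hx⟩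
    exact ⟨y, (h y).1 hx, rfl⟩
  · rintro ⟨y, hy, rfl⟩
    exact ⟨⟨y, rfl⟩, (h y).2 hy⟩

end Reflections

section Atlas

variable {E X : Type*} [NormedAddCommGroup E] [InnerProductSpace ℝ E] [MetricSpace X]
  (A : WeylAtlas E X) {f g h k : E → X} {u v w x y z α : E} {a b c : ℝ} {t : E ≃ₗᵢ[ℝ] E}

theorem inner_root_self (hα : α ∈ A.roots) : ⟪α, α⟫_ℝ = 1 := by
  rw [real_inner_self_eq_norm_sq, A.norm_root α hα]; norm_num

theorem inner_reflection (hα : α ∈ A.roots) (htx : ∀ x, t x = x - (2 * ⟪α, x⟫_ℝ) • α) (x : E) :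
    ⟪α, t x⟫_ℝ = -⟪α, x⟫_ℝ := by
  rw [htx, inner_sub_right, inner_smul_right, A.inner_root_self hα]; ring

theorem reflection_reflection (hα : α ∈ A.roots) (htx : ∀ x, t x = x - (2 * ⟪α, x⟫_ℝ) • α)
    (x : E) : t (t x) = x := by
  rw [htx (t x), A.inner_reflection hα htx, htx]; module

/-- Every vector in the wall separating two adjacent chambers is a difference of vectors in
both chambers. -/
theorem exists_sub_mem_panel (hα : α ∈ A.roots) (hu : Generic A.group u)
    (htx : ∀ x, t x = x - (2 * ⟪α, x⟫_ℝ) • α)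
    (hpos : ∀ β ∈ A.roots, 0 < ⟪β, u⟫_ℝ → β ≠ α → 0 < ⟪β, t u⟫_ℝ) (hy : ⟪α, y⟫_ℝ = 0) :
    ∃ p q, p ∈ chamber A.roots u ∧ p ∈ chamber A.roots (t u) ∧ q ∈ chamber A.roots u ∧
      q ∈ chamber A.roots (t u) ∧ y = p - q := by
  set m := u + t u with hm
  have hαm : ⟪α, m⟫_ℝ = 0 := by rw [hm, inner_add_right, A.inner_reflection hα htx]; ring
  obtain ⟨N, hN, hNm⟩ := exists_smul_add_nonneg A.finite_roots m y
  have h₁ : ∀ β ∈ A.roots, 0 < ⟪β, u⟫_ℝ → 0 ≤ ⟪β, N • m⟫_ℝ ∧ 0 ≤ ⟪β, N • m + y⟫_ℝ := by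
    intro β hβ hβu
    by_cases h : β = α
    · rw [h, inner_add_right, inner_smul_right, hαm, hy]; simp
    · have hβm : 0 < ⟪β, m⟫_ℝ := by
        rw [hm, inner_add_right]; exact add_pos hβu (hpos β hβ hβu h)
      exact ⟨by rw [inner_smul_right]; positivity, hNm β hβ hβm⟩
  have h₂ : ∀ β ∈ A.roots, 0 < ⟪β, t u⟫_ℝ → 0 ≤ ⟪β, N • m⟫_ℝ ∧ 0 ≤ ⟪β, N • m + y⟫_ℝ := by
    intro β hβ hβu
    rcases (A.regular_of_generic hu hβ).lt_or_gt with h | h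
    · by_cases h' : -β = α
      · rw [← h', inner_neg_left, neg_eq_zero] at hαm hy
        rw [inner_add_right, inner_smul_right, hαm, hy]; simp
      · have := hpos (-β) (A.neg_root β hβ) (by simpa using h) h'
        rw [inner_neg_left] at this
        linarith
    · exact h₁ β hβ h
  exact ⟨N • m + y, N • m, fun β hβ h => (h₁ β hβ h).2, fun β hβ h => (h₂ β hβ h).2,
    fun β hβ h => (h₁ β hβ h).1, fun β hβ h => (h₂ β hβ h).1, by abel⟩

theorem inner_eq_zero_of_mem_panel (hα : α ∈ A.roots) (hαu : 0 < ⟪α, u⟫_ℝ)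
    (htx : ∀ x, t x = x - (2 * ⟪α, x⟫_ℝ) • α) (h₁ : y ∈ chamber A.roots u)
    (h₂ : y ∈ chamber A.roots (t u)) : ⟪α, y⟫_ℝ = 0 := by
  have := h₂ (-α) (A.neg_root α hα)
    (by rw [inner_neg_left, A.inner_reflection hα htx]; simpa using hαu)
  rw [inner_neg_left] at this
  linarith [h₁ α hα hαu]

theorem asymp_comp (L : E ≃ₗᵢ[ℝ] E) : Asymp (fun x => f (L x)) x f (L x) :=
  ⟨0, fun T _ => by simp⟩

theorem neg_mem_chamber (hx : x ∈ chamber A.roots u) : -x ∈ chamber A.roots (-u) := by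
  intro β hβ h
  have := hx (-β) (A.neg_root β hβ) (by simpa using h)
  simpa using this

variable [CompleteSpace E]

/-- Two charts which are asymptotic on a half-space meet in a half-space. -/
theorem mem_range_iff_of_asymp (hf : f ∈ A.charts) (hg : g ∈ A.charts) (hα : α ∈ A.roots)
    (ha : ∀ x, 0 ≤ ⟪α, x⟫_ℝ → Asymp f x g x) :
    (∀ y, f y ∈ range g) ∨ ∃ a, ∀ y, f y ∈ range g ↔ a ≤ ⟪α, y⟫_ℝ := by
  have hcl := A.isClosed_preimage f hf g hg
  have hconv := A.convex_preimage f hf g hg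
  set K := {y | f y ∈ range g} with hK
  have hray : ∀ x, Generic A.group x → 0 ≤ ⟪α, x⟫_ℝ → ∃ p, ∀ T : ℝ, 0 ≤ T → p + T • x ∈ K := by
    intro x hx h
    obtain ⟨p, q, hpq⟩ := A.exists_eq_of_asymp hf hg hx (ha x h)
    exact ⟨p, fun T hT => ⟨_, (hpq _ (smul_mem_chamber hT self_mem_chamber)).symm⟩⟩
  have hadd : ∀ y ∈ K, ∀ x, 0 ≤ ⟪α, x⟫_ℝ → y + x ∈ K := by
    intro y hy
    have hcl' : IsClosed {x | y + x ∈ K} := hcl.preimage (by fun_prop)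
    have ho : IsOpen {x : E | 0 < ⟪α, x⟫_ℝ} := isOpen_lt continuous_const (by fun_prop)
    have hlt : {x : E | 0 < ⟪α, x⟫_ℝ} ⊆ {x | y + x ∈ K} := by
      refine ((dense_generic A.finite_group).open_subset_closure_inter ho).trans
        (hcl'.closure_subset_iff.2 ?_)
      rintro x ⟨hx, hgen⟩
      obtain ⟨p, hp⟩ := hray x hgen (le_of_lt hx)
      exact add_mem_of_ray hcl hconv hp hy
    intro x hx
    refine mem_of_forall_add_smul_mem (y := α) hcl' fun ε hε => hlt ?_
    simp only [mem_ofPred_eq, inner_add_right, inner_smul_right, A.inner_root_self hα]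
    linarith
  have hne : K.Nonempty := by
    obtain ⟨x, hx, _, hpos⟩ :=
      exists_generic_mem_chamber A.finite_group A.finite_roots A.neg_root α
    obtain ⟨p, hp⟩ := hray x hx (hpos α hα (by rw [A.inner_root_self hα]; norm_num)).le
    exact ⟨_, hp 0 le_rfl⟩
  by_cases huniv : ∀ y, y ∈ K
  · exact Or.inl huniv
  · right
    push Not at huniv
    obtain ⟨z, hz⟩ := huniv
    have hup : ∀ y ∈ K, ∀ x, ⟪α, y⟫_ℝ ≤ ⟪α, x⟫_ℝ → x ∈ K := fun y hy x hx => by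
      have := hadd y hy (x - y) (by rw [inner_sub_right]; linarith)
      rwa [add_sub_cancel] at this
    have hbdd : BddBelow ((fun y => ⟪α, y⟫_ℝ) '' K) := by
      refine ⟨⟪α, z⟫_ℝ, ?_⟩
      rintro _ ⟨y, hy, rfl⟩
      by_contra! hlt
      exact hz (hup y hy z hlt.le)
    refine ⟨sInf ((fun y => ⟪α, y⟫_ℝ) '' K), fun y => ⟨fun hy => csInf_le hbdd ⟨y, hy, rfl⟩,
      fun hy => ?_⟩⟩
    refine mem_of_forall_add_smul_mem (y := α) hcl fun ε hε => ?_
    obtain ⟨_, ⟨y', hy', rfl⟩, hlt⟩ := exists_lt_of_csInf_lt (hne.image _)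
      (show sInf ((fun y => ⟪α, y⟫_ℝ) '' K) < ⟪α, y⟫_ℝ + ε by linarith)
    refine hup y' hy' _ ?_
    rw [inner_add_right, inner_smul_right, A.inner_root_self hα]
    linarith

theorem exists_chart_half (hf : f ∈ A.charts) (hh : h ∈ A.charts) (hα : α ∈ A.roots)
    (hu : Generic A.group u) (ht : t ∈ A.group) (htx : ∀ x, t x = x - (2 * ⟪α, x⟫_ℝ) • α)
    (hαu : 0 < ⟪α, u⟫_ℝ) (hpos : ∀ β ∈ A.roots, 0 < ⟪β, u⟫_ℝ → β ≠ α → 0 < ⟪β, t u⟫_ℝ)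
    (ha : Asymp f u h u) :
    ∃ f₁ ∈ A.charts, Asymp f₁ (t u) h (t u) ∧ ∀ x, 0 ≤ ⟪α, x⟫_ℝ → Asymp f x f₁ x := by
  have hv : Generic A.group (t u) := hu.map ht
  obtain ⟨f₁, hf₁, L, hL, h₁, h₂⟩ := A.exists_chart_asymp hf hh hv.neg hv
  have hle := A.norm_sub_le_of_divergeLE hf hh hf hu ha Asymp.refl
    ((divergeLE_self (A.isometry f₁ hf₁) (L (t u)) (-(t u))).congr (h₂ _ self_mem_chamber).symm
      (h₁ _ self_mem_chamber).symm)
  have hLv : L (t u) = t u := by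
    have hn := L.norm_map (t u)
    have hsq := pow_le_pow_left₀ (norm_nonneg _) hle 2
    rw [sub_neg_eq_add, sub_neg_eq_add, norm_add_sq_real, norm_add_sq_real, hn,
      real_inner_self_eq_norm_sq] at hsq
    rw [← sub_eq_zero, ← norm_eq_zero, ← sq_eq_zero_iff]
    refine le_antisymm ?_ (sq_nonneg _)
    rw [norm_sub_sq_real, hn]
    linarith
  have hL1 := hv L hL hLv
  subst hL1
  have hP : ∀ p, p ∈ chamber A.roots u → p ∈ chamber A.roots (t u) → Asymp f p f₁ p :=
    fun p hp hp' => (A.asymp_of_mem_chamber hf hh hu ha hp).trans (h₂ p hp')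
  refine ⟨f₁, hf₁, (h₂ _ self_mem_chamber).symm, fun x hx => ?_⟩
  set r := ⟪α, x⟫_ℝ / ⟪α, u⟫_ℝ with hr
  have hy : ⟪α, x - r • (-(t u))⟫_ℝ = 0 := by
    rw [inner_sub_right, inner_smul_right, inner_neg_right, A.inner_reflection hα htx, neg_neg,
      hr, div_mul_cancel₀ _ hαu.ne', sub_self]
  obtain ⟨p, q, hp, hp', hq, hq', e⟩ := A.exists_sub_mem_panel hα hu htx hpos hy
  have : x = r • (-(t u)) + (p + -q) := by rw [← sub_eq_add_neg, ← e]; abel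
  rw [this]
  exact A.asymp_add hf hf₁ (h₁ _ (smul_mem_chamber (div_nonneg hx hαu.le) self_mem_chamber))
    (A.asymp_add hf hf₁ (hP p hp hp') (h₁ _ (A.neg_mem_chamber hq')))

/-- Let `f` contain the chamber of `u` at infinity, and let `h` contain an adjacent chamber as
well. Then either `f` contains the latter, or `f` is covered by two charts containing it. -/
theorem sundial (hf : f ∈ A.charts) (hh : h ∈ A.charts) (hα : α ∈ A.roots)
    (hu : Generic A.group u) (ht : t ∈ A.group) (htx : ∀ x, t x = x - (2 * ⟪α, x⟫_ℝ) • α)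
    (hαu : 0 < ⟪α, u⟫_ℝ) (hpos : ∀ β ∈ A.roots, 0 < ⟪β, u⟫_ℝ → β ≠ α → 0 < ⟪β, t u⟫_ℝ)
    (ha : Asymp f u h u) :
    Asymp f (t u) h (t u) ∨ ∃ f₁ ∈ A.charts, ∃ f₂ ∈ A.charts,
      Asymp f₁ (t u) h (t u) ∧ Asymp f₂ (t u) h (t u) ∧ range f ⊆ range f₁ ∪ range f₂ := by
  have hv : Generic A.group (t u) := hu.map ht
  have hf' := A.comp_mem f hf t ht
  have htt := A.reflection_reflection hα htx
  have htfix : ∀ y, ⟪α, y⟫_ℝ = 0 → t y = y := fun y hy => by rw [htx, hy]; simp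
  obtain ⟨h₂, hh₂, L, hL, e₁, e₂⟩ := A.exists_chart_asymp hf' hh hu hv
  have hLp : ∀ p, p ∈ chamber A.roots u → p ∈ chamber A.roots (t u) → L p = p := by
    intro p hp hp'
    have h1 : Asymp (fun x => f (t x)) p f (t p) := asymp_comp t
    rw [htfix p (A.inner_eq_zero_of_mem_panel hα hαu htx hp hp')] at h1
    exact (((e₂ p hp').symm.trans ((A.asymp_of_mem_chamber hf hh hu ha hp).symm.trans
      (h1.symm.trans (e₁ p hp)))).eq (A.isometry h₂ hh₂))
  have hLy : ∀ y, ⟪α, y⟫_ℝ = 0 → L y = y := by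
    intro y hy
    obtain ⟨p, q, hp, hp', hq, hq', rfl⟩ := A.exists_sub_mem_panel hα hu htx hpos hy
    rw [map_sub, hLp p hp hp', hLp q hq hq']
  rcases eq_one_or_eq_reflection L (A.norm_root α hα) hLy with hL1 | hLt
  swap
  · left
    have h1 := e₂ (t u) self_mem_chamber
    rw [hLt, ← htx, htt] at h1
    exact (h1.trans ((e₁ u self_mem_chamber).symm.trans (asymp_comp t))).symm
  right
  have e₃ := e₂ (t u) self_mem_chamber
  rw [hL1] at e₃
  obtain ⟨f₁, hf₁, a₁, b₁⟩ := A.exists_chart_half hf hh hα hu ht htx hαu hpos ha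
  obtain ⟨f₂, hf₂, a₂, b₂⟩ :=
    A.exists_chart_half hf' hh₂ hα hu ht htx hαu hpos (e₁ u self_mem_chamber)
  have a₂' := a₂.trans e₃.symm
  refine ⟨f₁, hf₁, f₂, hf₂, a₁, a₂', ?_⟩
  have b₃ : ∀ x, 0 ≤ ⟪-α, x⟫_ℝ → Asymp f₁ x f₂ x := by
    intro x hx
    set r := ⟪-α, x⟫_ℝ / ⟪α, u⟫_ℝ with hr
    have hy : ⟪α, x - r • t u⟫_ℝ = 0 := by
      rw [inner_sub_right, inner_smul_right, A.inner_reflection hα htx, hr, mul_neg,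
        div_mul_cancel₀ _ hαu.ne', inner_neg_left]; ring
    have h1 : Asymp (fun x => f (t x)) (x - r • t u) f (t (x - r • t u)) := asymp_comp t
    rw [htfix _ hy] at h1
    have h2 := A.asymp_add hf₁ hf₂
      ((b₁ _ hy.ge).symm.trans (h1.symm.trans (b₂ _ hy.ge)))
      (Asymp.smul (c := r) (a₁.trans a₂'.symm) (div_nonneg hx hαu.le))
    rwa [sub_add_cancel] at h2
  have hmem : ∀ y, f y = (fun x => f (t x)) (t y) := fun y => by simp [htt]
  rcases A.mem_range_iff_of_asymp hf hf₁ hα b₁ with c₁ | ⟨a, c₁⟩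
  · rintro _ ⟨y, rfl⟩; exact Or.inl (c₁ y)
  rcases A.mem_range_iff_of_asymp hf' hf₂ hα b₂ with c₂ | ⟨b, c₂⟩
  · rintro _ ⟨y, rfl⟩; rw [hmem]; exact Or.inr (c₂ _)
  have c₂' : ∀ y, f y ∈ range f₂ ↔ b ≤ ⟪-α, y⟫_ℝ := fun y => by
    rw [hmem, c₂, A.inner_reflection hα htx, inner_neg_left]
  have hab : a ≤ -b := by
    rcases A.mem_range_iff_of_asymp hf₁ hf₂ (A.neg_root α hα) b₃ with c₃ | ⟨c, c₃⟩
    · exfalso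
      have hr : ∀ r : ℝ, ⟪α, r • α⟫_ℝ = r := fun r => by
        rw [inner_smul_right, A.inner_root_self hα, mul_one]
      obtain ⟨y, hy⟩ := (c₁ ((max a (-b + 1)) • α)).2 (by rw [hr]; exact le_max_left _ _)
      have h1 := (c₂' ((max a (-b + 1)) • α)).1 (by rw [← hy]; exact c₃ y)
      rw [inner_neg_left, hr] at h1
      linarith [le_max_right a (-b + 1)]
    · obtain ⟨_, ⟨⟨y, rfl⟩, h1⟩, h2⟩ := A.inter_nonempty f hf f₁ hf₁ f₂ hf₂
        ⟨f, hf, α, hα, a, range_inter_range_eq c₁⟩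
        ⟨f₁, hf₁, -α, A.neg_root α hα, c, range_inter_range_eq c₃⟩
        ⟨f, hf, -α, A.neg_root α hα, b, range_inter_range_eq c₂'⟩
      have h1 := (c₁ y).1 h1
      have h2 := (c₂' y).1 h2
      rw [inner_neg_left] at h2
      linarith
  rintro _ ⟨y, rfl⟩
  rcases le_total a ⟪α, y⟫_ℝ with h1 | h1
  · exact Or.inl ((c₁ y).2 h1)
  · exact Or.inr ((c₂' y).2 (by rw [inner_neg_left]; linarith))

/-- If the chambers of `u` and `v` are distinct, then some wall of the chamber of `u` separates
them. -/
theorem exists_separating_wall (hv : Generic A.group v)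
    (hsep : ∃ β ∈ A.roots, 0 < ⟪β, u⟫_ℝ ∧ ⟪β, v⟫_ℝ < 0) :
    ∃ α ∈ A.roots, 0 < ⟪α, u⟫_ℝ ∧ ⟪α, v⟫_ℝ < 0 ∧ ∃ w, Generic A.group w ∧
      (∀ β ∈ A.roots, 0 < ⟪β, u⟫_ℝ → 0 < ⟪β, w⟫_ℝ) ∧
      ∀ β ∈ A.roots, 0 < ⟪β, u⟫_ℝ → β ≠ α → 0 < ⟪β, w - (2 * ⟪α, w⟫_ℝ) • α⟫_ℝ := by
  set S := {β ∈ A.roots | 0 < ⟪β, u⟫_ℝ ∧ ⟪β, v⟫_ℝ < 0} with hS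
  have hSfin : S.Finite := A.finite_roots.subset fun β h => h.1
  have hSne : S.Nonempty := by
    obtain ⟨β, h1, h2⟩ := hsep; exact ⟨β, h1, h2⟩
  set P := {β ∈ A.roots | 0 < ⟪β, u⟫_ℝ} with hP
  have hPfin : P.Finite := A.finite_roots.subset fun β h => h.1
  set B := (fun p : E × E => ⟪p.2, v⟫_ℝ • p.1 - ⟪p.1, v⟫_ℝ • p.2) ''
    {p ∈ S ×ˢ S | p.1 ≠ p.2} with hB
  have hBfin : B.Finite := ((hSfin.prod hSfin).subset fun p h => h.1).image _
  have hB0 : ∀ b ∈ B, b ≠ 0 := by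
    rintro _ ⟨⟨β, γ⟩, ⟨⟨hβ, hγ⟩, hne⟩, rfl⟩ h0
    apply hne
    have h0 : ⟪γ, v⟫_ℝ • β = ⟪β, v⟫_ℝ • γ := sub_eq_zero.1 h0
    have hn := congrArg norm h0
    rw [norm_smul, norm_smul, A.norm_root β hβ.1, A.norm_root γ hγ.1, mul_one, mul_one,
      Real.norm_of_nonpos hγ.2.2.le, Real.norm_of_nonpos hβ.2.2.le, neg_inj] at hn
    rw [hn] at h0
    exact smul_right_injective E hβ.2.2.ne h0
  have ho : IsOpen (⋂ β ∈ P, {x : E | 0 < ⟪β, x⟫_ℝ}) :=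
    hPfin.isOpen_biInter fun β _ => isOpen_lt continuous_const (by fun_prop)
  obtain ⟨u', hu', hoff⟩ := (dense_inner_ne_zero hBfin hB0).inter_open_nonempty _ ho
    ⟨u, by simp [hP]⟩
  simp only [mem_iInter, mem_ofPred_eq] at hu' hoff
  obtain ⟨α, hαS, hmin⟩ := hSfin.exists_minimalFor (fun β => ⟪β, u'⟫_ℝ / -⟪β, v⟫_ℝ) S hSne
  set r := ⟪α, u'⟫_ℝ / -⟪α, v⟫_ℝ with hr
  have hαv : 0 < -⟪α, v⟫_ℝ := by linarith [hαS.2.2]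
  have hr0 : 0 < r := div_pos (hu' α ⟨hαS.1, hαS.2.1⟩) hαv
  have hm : ∀ β ∈ P, β ≠ α → 0 < ⟪β, u' + r • v⟫_ℝ := by
    intro β hβ hne
    rw [inner_add_right, inner_smul_right]
    have hβu := hu' β hβ
    rcases (A.regular_of_generic hv hβ.1).lt_or_gt with h | h
    · have hβv : 0 < -⟪β, v⟫_ℝ := by linarith
      have hle : r ≤ ⟪β, u'⟫_ℝ / -⟪β, v⟫_ℝ := by
        by_contra! hlt
        exact absurd (hmin (j := β) ⟨hβ.1, hβ.2, h⟩ hlt.le) (not_le.2 hlt)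
      rw [le_div_iff₀ hβv] at hle
      have hne' := hoff _ ⟨(β, α), ⟨⟨⟨hβ.1, hβ.2, h⟩, hαS⟩, hne⟩, rfl⟩
      simp only [inner_sub_left, inner_smul_left, conj_trivial] at hne'
      refine lt_of_le_of_ne (by linarith) fun h0 => hne' ?_
      have h1 : r * -⟪α, v⟫_ℝ = ⟪α, u'⟫_ℝ := div_mul_cancel₀ _ hαv.ne'
      rw [← h1]
      have h2 : ⟪β, u'⟫_ℝ = -(r * ⟪β, v⟫_ℝ) := by linarith
      rw [h2]; ring
    · have := mul_pos hr0 h; linarith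
  have hαm : ⟪α, u' + r • v⟫_ℝ = 0 := by
    rw [inner_add_right, inner_smul_right]
    have h1 : r * -⟪α, v⟫_ℝ = ⟪α, u'⟫_ℝ := div_mul_cancel₀ _ hαv.ne'
    linarith
  set m := u' + r • v with hmdef
  obtain ⟨ε, hε, hεm⟩ : ∃ ε : ℝ, 0 < ε ∧ ∀ β ∈ {β ∈ P | β ≠ α},
      0 < ⟪β, m + ε • α⟫_ℝ ∧ 0 < ⟪β, m - ε • α⟫_ℝ := by
    have : ∀ᶠ ε : ℝ in 𝓝[>] 0, ∀ β ∈ {β ∈ P | β ≠ α},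
        0 < ⟪β, m + ε • α⟫_ℝ ∧ 0 < ⟪β, m - ε • α⟫_ℝ := by
      refine (eventually_all_finite (hPfin.subset fun β h => h.1)).2 fun β hβ => ?_
      have h0 := hm β hβ.1 hβ.2
      have c1 : Continuous fun ε : ℝ => ⟪β, m + ε • α⟫_ℝ := by fun_prop
      have c2 : Continuous fun ε : ℝ => ⟪β, m - ε • α⟫_ℝ := by fun_prop
      exact nhdsWithin_le_nhds (((c1.tendsto 0).eventually_const_lt (by simpa using h0)).and
        ((c2.tendsto 0).eventually_const_lt (by simpa using h0)))
    obtain ⟨ε, h1, h2⟩ := (this.and self_mem_nhdsWithin).exists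
    exact ⟨ε, h2, h1⟩
  have ho' : IsOpen ({x : E | 0 < ⟪α, x⟫_ℝ} ∩ ⋂ β ∈ {β ∈ P | β ≠ α},
      ({x : E | 0 < ⟪β, x⟫_ℝ} ∩ {x : E | 0 < ⟪β, x - (2 * ⟪α, x⟫_ℝ) • α⟫_ℝ})) :=
    (isOpen_lt continuous_const (by fun_prop)).inter
      ((hPfin.subset fun β h => h.1).isOpen_biInter fun β _ =>
        (isOpen_lt continuous_const (by fun_prop)).inter
          (isOpen_lt continuous_const (by fun_prop)))
  have hαε : ⟪α, m + ε • α⟫_ℝ = ε := by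
    rw [inner_add_right, hαm, inner_smul_right, A.inner_root_self hαS.1]; ring
  obtain ⟨w, ⟨hw0, hw⟩, hgen⟩ := (dense_generic A.finite_group).inter_open_nonempty _ ho'
    ⟨m + ε • α, by
      refine ⟨by simpa [hαε] using hε, mem_iInter₂.2 fun β hβ => ⟨(hεm β hβ).1, ?_⟩⟩
      have : m + ε • α - (2 * ⟪α, m + ε • α⟫_ℝ) • α = m - ε • α := by rw [hαε]; module
      simpa only [mem_ofPred_eq, this] using (hεm β hβ).2⟩
  rw [mem_iInter₂] at hw
  refine ⟨α, hαS.1, hαS.2.1, hαS.2.2, w, hgen, fun β hβ h => ?_, fun β hβ h hne =>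
    (hw β ⟨⟨hβ, h⟩, hne⟩).2⟩
  by_cases hne : β = α
  · rw [hne]; exact hw0
  · exact (hw β ⟨⟨hβ, h⟩, hne⟩).1

/-- A chart is covered by finitely many charts containing a given chamber at infinity. -/
theorem exists_finite_cover (hh : h ∈ A.charts) (hv : Generic A.group v) (N : ℕ) :
    ∀ u f, Generic A.group u → {β ∈ A.roots | 0 < ⟪β, u⟫_ℝ ∧ ⟪β, v⟫_ℝ < 0}.ncard ≤ N →
      f ∈ A.charts → Asymp f u h u → ∃ 𝒢 ⊆ A.charts, 𝒢.Finite ∧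
        (∀ x, ∃ g ∈ 𝒢, f x ∈ range g) ∧ ∀ g ∈ 𝒢, Asymp g v h v := by
  have hbase : ∀ u f, Generic A.group u →
      ¬ (∃ β ∈ A.roots, 0 < ⟪β, u⟫_ℝ ∧ ⟪β, v⟫_ℝ < 0) →
      f ∈ A.charts → Asymp f u h u → ∃ 𝒢 ⊆ A.charts, 𝒢.Finite ∧
        (∀ x, ∃ g ∈ 𝒢, f x ∈ range g) ∧ ∀ g ∈ 𝒢, Asymp g v h v := by
    intro u f hu hsep hf ha
    push Not at hsep
    refine ⟨{f}, by simpa using hf, finite_singleton f, fun x => ⟨f, rfl, x, rfl⟩, ?_⟩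
    rintro _ rfl
    exact A.asymp_of_mem_chamber hf hh hu ha fun β hβ h => hsep β hβ h
  have hfin : ∀ u, {β ∈ A.roots | 0 < ⟪β, u⟫_ℝ ∧ ⟪β, v⟫_ℝ < 0}.Finite := fun u =>
    A.finite_roots.subset fun β h => h.1
  induction N with
  | zero =>
    intro u f hu hN hf ha
    refine hbase u f hu ?_ hf ha
    rintro ⟨β, hβ⟩
    have := (ncard_eq_zero (hfin u)).1 (Nat.le_zero.1 hN)
    exact (this ▸ (show β ∈ {β ∈ A.roots | 0 < ⟪β, u⟫_ℝ ∧ ⟪β, v⟫_ℝ < 0} from hβ) :)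
  | succ N ih =>
    intro u f hu hN hf ha
    by_cases hsep : ∃ β ∈ A.roots, 0 < ⟪β, u⟫_ℝ ∧ ⟪β, v⟫_ℝ < 0
    swap
    · exact hbase u f hu hsep hf ha
    obtain ⟨α, hα, hαu, hαv, w, hw, hpos, hpos'⟩ := A.exists_separating_wall hv hsep
    obtain ⟨t, ht, htx⟩ := A.refl_mem α hα
    have hcard : {β ∈ A.roots | 0 < ⟪β, t w⟫_ℝ ∧ ⟪β, v⟫_ℝ < 0}.ncard ≤ N := by
      refine Nat.lt_succ_iff.1 (lt_of_lt_of_le (ncard_lt_ncard ⟨?_, fun hsub => ?_⟩ (hfin u)) hN)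
      · rintro β ⟨hβ, h1, h2⟩
        refine ⟨hβ, ?_, h2⟩
        rcases (A.regular_of_generic hu hβ).lt_or_gt with h | h
        · exfalso
          by_cases hne : -β = α
          · rw [← hne, inner_neg_left] at hαv; linarith
          · have := hpos' (-β) (A.neg_root β hβ) (by simpa using h) hne
            rw [← htx, inner_neg_left] at this
            linarith
        · exact h
      · have := (hsub ⟨hα, hαu, hαv⟩).2.1
        rw [A.inner_reflection hα htx] at this
        linarith [hpos α hα hαu]
    have haw : Asymp f w h w :=
      A.asymp_of_mem_chamber hf hh hu ha fun β hβ h => (hpos β hβ h).le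
    have hposw : ∀ β ∈ A.roots, 0 < ⟪β, w⟫_ℝ → β ≠ α → 0 < ⟪β, t w⟫_ℝ := by
      intro β hβ h hne
      rw [htx]
      refine hpos' β hβ ?_ hne
      rcases (A.regular_of_generic hu hβ).lt_or_gt with h' | h'
      · have := hpos (-β) (A.neg_root β hβ) (by simpa using h')
        rw [inner_neg_left] at this
        linarith
      · exact h'
    rcases A.sundial hf hh hα hw ht htx (hpos α hα hαu) hposw haw with
      h1 | ⟨f₁, hf₁, f₂, hf₂, h1, h2, hcov⟩
    · exact ih _ _ (hw.map ht) hcard hf h1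
    · obtain ⟨𝒢₁, s₁, fin₁, c₁, a₁⟩ := ih _ _ (hw.map ht) hcard hf₁ h1
      obtain ⟨𝒢₂, s₂, fin₂, c₂, a₂⟩ := ih _ _ (hw.map ht) hcard hf₂ h2
      refine ⟨𝒢₁ ∪ 𝒢₂, union_subset s₁ s₂, fin₁.union fin₂, fun x => ?_, ?_⟩
      · rcases hcov ⟨x, rfl⟩ with ⟨y, hy⟩ | ⟨y, hy⟩
        · obtain ⟨g, hg, hy'⟩ := c₁ y
          exact ⟨g, Or.inl hg, hy ▸ hy'⟩
        · obtain ⟨g, hg, hy'⟩ := c₂ y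
          exact ⟨g, Or.inr hg, hy ▸ hy'⟩
      · rintro g (hg | hg)
        · exact a₁ g hg
        · exact a₂ g hg

/-- A point and the germ of a segment lie in a common chart. -/
theorem exists_chart_segment_germ (hf : f ∈ A.charts) (hk : k ∈ A.charts) {a₀ a₁ : E}
    (ha : k a₁ = f a₀) (d z : E) : ∃ g ∈ A.charts, k z ∈ range g ∧
      ∃ s : ℝ, 0 < s ∧ ∀ t ∈ Icc 0 s, f (a₀ + t • d) ∈ range g := by
  obtain ⟨v, hv, hz, _⟩ :=
    exists_generic_mem_chamber A.finite_group A.finite_roots A.neg_root (z - a₁)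
  obtain ⟨h, hh, L, hL, h₁, h₂⟩ := A.exists_chart_asymp hk hf hv hv
  have hLf := A.comp_mem f hf L⁻¹ (A.group.inv_mem hL)
  have hLLv : L⁻¹ (L v) = v := L.symm_apply_apply v
  have e₁ : Asymp (fun x => f (L⁻¹ x)) (L v) f (L⁻¹ (L v)) := asymp_comp L⁻¹
  rw [hLLv] at e₁
  obtain ⟨𝒢, hsub, hfin, hcov, has⟩ := A.exists_finite_cover hh hv _ (L v) _ (hv.map hL) le_rfl
    hLf (e₁.trans (h₂ v self_mem_chamber))
  obtain ⟨_, ⟨g, hg, rfl⟩, s, hs, hseg⟩ := exists_initial_segment_mem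
    (𝒦 := (fun g => {x | f x ∈ range g}) '' 𝒢) (hfin.image _)
    (by rintro _ ⟨g, hg, rfl⟩; exact A.isClosed_preimage f hf g (hsub hg))
    (by rintro _ ⟨g, hg, rfl⟩; exact A.convex_preimage f hf g (hsub hg))
    (fun x => by
      obtain ⟨g, hg, hx⟩ := hcov (L x)
      have hLLx : L⁻¹ (L x) = x := L.symm_apply_apply x
      rw [hLLx] at hx
      exact ⟨_, ⟨g, hg, rfl⟩, hx⟩) a₀ d
  refine ⟨g, hsub hg, ?_, s, hs, hseg⟩
  have ha₁ : k a₁ ∈ range g := by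
    have := hseg 0 ⟨le_rfl, hs.le⟩
    rw [zero_smul, add_zero] at this
    rw [ha]; exact this
  obtain ⟨p, q, hpq⟩ := A.exists_eq_of_asymp hk (hsub hg) hv
    ((h₁ v self_mem_chamber).trans (has g hg).symm)
  have := add_mem_of_ray (A.isClosed_preimage k hk g (hsub hg))
    (A.convex_preimage k hk g (hsub hg)) (p := p) (x := z - a₁)
    (fun T hT => ⟨_, (hpq _ (smul_mem_chamber hT hz)).symm⟩) ha₁
  rwa [add_sub_cancel] at this

end Atlas
end WeylAtlas

namespace SphericalCoxeterSystem

open WeylAtlas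
open scoped InnerProductSpace

variable {n : ℕ} (cs : SphericalCoxeterSystem n) {u v x y α β : ModelSpace n} {c : ℝ}
  {w r : ModelSpace n ≃ᵢ ModelSpace n} {M H F : Set (ModelSpace n)}

theorem map_zero_of_mem_Wbar (hw : w ∈ cs.Wbar) : w 0 = 0 := by
  induction hw using Subgroup.closure_induction with
  | mem s hs =>
    obtain ⟨_, _, p, _, hp⟩ := cs.refl s hs
    have : (0 : ModelSpace n) ∈ {x | s x = x} := by rw [hp]; simp
    exact this
  | one => rfl
  | mul a b _ _ ha hb => rw [IsometryEquiv.mul_apply, hb, ha]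
  | inv a _ ha =>
    have := IsometryEquiv.inv_apply_self a 0
    rwa [ha] at this

/-- The finite reflection group, as a group of linear isometries. -/
def linearGroup : Subgroup (ModelSpace n ≃ₗᵢ[ℝ] ModelSpace n) where
  carrier := {L | L.toIsometryEquiv ∈ cs.Wbar}
  mul_mem' ha hb := cs.Wbar.mul_mem ha hb
  one_mem' := cs.Wbar.one_mem
  inv_mem' ha := cs.Wbar.inv_mem ha

theorem exists_mem_linearGroup (hw : w ∈ cs.Wbar) : ∃ L ∈ cs.linearGroup, ∀ x, L x = w x := by
  have h0 := cs.map_zero_of_mem_Wbar hw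
  have h : (w.toRealLinearIsometryEquivOfMapZero h0).toIsometryEquiv = w :=
    IsometryEquiv.ext fun x => rfl
  refine ⟨w.toRealLinearIsometryEquivOfMapZero h0, ?_, fun x => rfl⟩
  change _ ∈ cs.Wbar
  rwa [h]

theorem finite_linearGroup :
    (cs.linearGroup : Set (ModelSpace n ≃ₗᵢ[ℝ] ModelSpace n)).Finite := by
  have : (cs.Wbar : Set (ModelSpace n ≃ᵢ ModelSpace n)).Finite := cs.finiteW
  refine Set.Finite.of_finite_image (f := LinearIsometryEquiv.toIsometryEquiv)
    (this.subset ?_) (LinearIsometryEquiv.toIsometryEquiv_injective.injOn)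
  rintro _ ⟨L, hL, rfl⟩
  exact hL

theorem exists_eq_add_of_mem_W (hw : w ∈ cs.W) :
    ∃ L ∈ cs.linearGroup, ∃ τ, ∀ x, w x = L x + τ := by
  induction hw using Subgroup.closure_induction with
  | mem s hs =>
    rcases hs with hs | ⟨v, hv⟩
    · obtain ⟨L, hL, h⟩ := cs.exists_mem_linearGroup (Subgroup.subset_closure hs)
      exact ⟨L, hL, 0, fun x => by rw [h, add_zero]⟩
    · exact ⟨1, cs.linearGroup.one_mem, v, hv⟩
  | one => exact ⟨1, cs.linearGroup.one_mem, 0, fun x => by simp⟩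
  | mul a b _ _ ha hb =>
    obtain ⟨L, hL, τ, h⟩ := ha
    obtain ⟨L', hL', τ', h'⟩ := hb
    refine ⟨L * L', cs.linearGroup.mul_mem hL hL', L τ' + τ, fun x => ?_⟩
    rw [IsometryEquiv.mul_apply, h, h', map_add, add_assoc]
    rfl
  | inv a _ ha =>
    obtain ⟨L, hL, τ, h⟩ := ha
    refine ⟨L⁻¹, cs.linearGroup.inv_mem hL, -(L⁻¹ τ), fun x => ?_⟩
    apply a.injective
    rw [IsometryEquiv.apply_inv_self, h, map_add, map_neg]
    have : ∀ z, L (L⁻¹ z) = z := L.apply_symm_apply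
    rw [this, this]
    abel

theorem Wbar_le_W : cs.Wbar ≤ cs.W := Subgroup.closure_mono subset_union_left

/-- The unit normal vectors of the linear walls. -/
def roots : Set (ModelSpace n) :=
  {α | ‖α‖ = 1 ∧ ∃ s ∈ cs.S, ∃ w ∈ cs.Wbar, ∀ x, (w * s * w⁻¹) x = x - (2 * ⟪α, x⟫_ℝ) • α}

theorem eq_or_eq_neg_of_forall_inner (hα : ‖α‖ = 1) (hβ : ‖β‖ = 1)
    (h : ∀ y, ⟪α, y⟫_ℝ = 0 → ⟪β, y⟫_ℝ = 0) : β = α ∨ β = -α := by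
  have hαα : ⟪α, α⟫_ℝ = 1 := by rw [real_inner_self_eq_norm_sq, hα]; norm_num
  have h0 : ⟪α, β - ⟪α, β⟫_ℝ • α⟫_ℝ = 0 := by
    rw [inner_sub_right, inner_smul_right, hαα]; ring
  have h1 := h _ h0
  have h2 : β = ⟪α, β⟫_ℝ • α := by
    rw [← sub_eq_zero, ← inner_self_eq_zero (𝕜 := ℝ), inner_sub_left, h1, inner_smul_left, h0]
    simp
  have h3 : |⟪α, β⟫_ℝ| = 1 := by
    have := congrArg norm h2
    rw [norm_smul, hα, hβ, mul_one, Real.norm_eq_abs] at this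
    exact this.symm
  rcases eq_or_eq_neg_of_abs_eq h3 with h4 | h4 <;> rw [h4] at h2
  · left; simpa using h2
  · right; simpa using h2

theorem finite_roots : cs.roots.Finite := by
  have hW : (cs.Wbar : Set (ModelSpace n ≃ᵢ ModelSpace n)).Finite := cs.finiteW
  refine (hW.biUnion (t := fun g => {α | ‖α‖ = 1 ∧ ∀ x, g x = x - (2 * ⟪α, x⟫_ℝ) • α})
    fun g _ => ?_).subset ?_
  · rcases Set.eq_empty_or_nonempty {α | ‖α‖ = 1 ∧ ∀ x, g x = x - (2 * ⟪α, x⟫_ℝ) • α} with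
      h | ⟨α, hα, hαx⟩
    · rw [h]; exact finite_empty
    · refine (Set.toFinite {α, -α}).subset ?_
      rintro β ⟨hβ, hβx⟩
      refine eq_or_eq_neg_of_forall_inner hα hβ fun y hy => ?_
      have h1 := (hαx y).symm.trans (hβx y)
      rw [hy, mul_zero, zero_smul, sub_right_inj, eq_comm, smul_eq_zero] at h1
      rcases h1 with h1 | h1
      · linarith
      · rw [h1, inner_zero_left]
  · rintro α ⟨hα, s, hs, w, hw, h⟩
    exact mem_biUnion (cs.Wbar.mul_mem (cs.Wbar.mul_mem hw (Subgroup.subset_closure hs))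
      (cs.Wbar.inv_mem hw)) ⟨hα, h⟩

theorem inner_root_self (hα : α ∈ cs.roots) : ⟪α, α⟫_ℝ = 1 := by
  rw [real_inner_self_eq_norm_sq, hα.1]; norm_num

theorem neg_mem_roots (hα : α ∈ cs.roots) : -α ∈ cs.roots := by
  obtain ⟨hα, s, hs, w, hw, h⟩ := hα
  refine ⟨by rwa [norm_neg], s, hs, w, hw, fun x => ?_⟩
  rw [h, inner_neg_left]
  module

theorem map_mem_roots {L : ModelSpace n ≃ₗᵢ[ℝ] ModelSpace n} (hL : L ∈ cs.linearGroup)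
    (hα : α ∈ cs.roots) : L α ∈ cs.roots := by
  obtain ⟨hα, s, hs, w, hw, h⟩ := hα
  refine ⟨by rwa [L.norm_map], s, hs, L.toIsometryEquiv * w, cs.Wbar.mul_mem hL hw, fun x => ?_⟩
  have h1 : (L.toIsometryEquiv * w * s * (L.toIsometryEquiv * w)⁻¹) x
      = L ((w * s * w⁻¹) (L.symm x)) := by
    rw [mul_inv_rev]; rfl
  rw [h1, h, map_sub, map_smul, L.apply_symm_apply, ← L.inner_map_map α, L.apply_symm_apply]

theorem exists_root_of_mem {s : ModelSpace n ≃ᵢ ModelSpace n} (hs : s ∈ cs.S) :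
    ∃ α ∈ cs.roots, ∀ x, s x = x - (2 * ⟪α, x⟫_ℝ) • α := by
  obtain ⟨_, hs1, p, hp0, hp⟩ := cs.refl s hs
  obtain ⟨L, hL, hLs⟩ := cs.exists_mem_linearGroup (Subgroup.subset_closure hs)
  set b := (InnerProductSpace.toDual ℝ (ModelSpace n)).symm (LinearMap.toContinuousLinearMap p)
    with hb
  have hbp : ∀ x, ⟪b, x⟫_ℝ = p x := fun x => by
    rw [hb, InnerProductSpace.toDual_symm_apply]; rfl
  have hb0 : b ≠ 0 := fun h0 => hp0 (by ext x; rw [← hbp, h0]; simp)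
  have hn : ‖‖b‖⁻¹ • b‖ = 1 := by
    rw [norm_smul, norm_inv, norm_norm, inv_mul_cancel₀ (norm_ne_zero_iff.2 hb0)]
  have key := eq_one_or_eq_reflection L hn fun y hy => by
    rw [inner_smul_left, mul_eq_zero] at hy
    have hy : p y = 0 := by
      rcases hy with hy | hy
      · exact absurd hy (by simpa using hb0)
      · rw [← hbp, hy]
    have : y ∈ {x | s x = x} := by rw [hp]; exact hy
    rw [hLs]; exact this
  have h : ∀ x, s x = x - (2 * ⟪‖b‖⁻¹ • b, x⟫_ℝ) • (‖b‖⁻¹ • b) := by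
    rcases key with h | h
    · exact absurd (IsometryEquiv.ext fun x => by rw [← hLs, h]; rfl) hs1
    · exact fun x => by rw [← hLs, h]
  exact ⟨_, ⟨hn, s, hs, 1, cs.Wbar.one_mem, fun x => by simpa using h x⟩, h⟩

theorem IsAffineReflection.exists_root (hr : cs.IsAffineReflection r) :
    ∃ α ∈ cs.roots, ∃ c : ℝ, ∀ x, r x = x - (2 * (⟪α, x⟫_ℝ - c)) • α := by
  obtain ⟨s, hs, w, hw, rfl⟩ := hr
  obtain ⟨α, hα, hαs⟩ := cs.exists_root_of_mem hs
  obtain ⟨L, hL, τ, h⟩ := cs.exists_eq_add_of_mem_W hw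
  refine ⟨L α, cs.map_mem_roots hL hα, ⟪L α, τ⟫_ℝ, fun x => ?_⟩
  obtain ⟨y, rfl⟩ := w.surjective x
  rw [IsometryEquiv.mul_apply, IsometryEquiv.mul_apply, IsometryEquiv.inv_apply_self, hαs, h, h,
    map_sub, map_smul, inner_add_right, L.inner_map_map]
  module

theorem exists_isAffineReflection (hα : α ∈ cs.roots) (c : ℝ) :
    ∃ r, cs.IsAffineReflection r ∧ ∀ x, r x = x - (2 * (⟪α, x⟫_ℝ - c)) • α := by
  have hαα := cs.inner_root_self hα
  obtain ⟨-, s, hs, w, hw, h⟩ := hα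
  set t : ModelSpace n ≃ᵢ ModelSpace n := IsometryEquiv.addRight (c • α) with ht
  have htx : ∀ x, t x = x + c • α := fun x => rfl
  have htW : t ∈ cs.W := Subgroup.subset_closure (Or.inr ⟨c • α, htx⟩)
  refine ⟨t * w * s * (t * w)⁻¹, ⟨s, hs, t * w, cs.W.mul_mem htW (cs.Wbar_le_W hw), rfl⟩,
    fun x => ?_⟩
  obtain ⟨y, rfl⟩ := t.surjective x
  have h1 : (t * w * s * (t * w)⁻¹) (t y) = t ((w * s * w⁻¹) (t⁻¹ (t y))) := by
    rw [mul_inv_rev]; rfl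
  rw [h1, IsometryEquiv.inv_apply_self, h, htx, htx, inner_add_right, inner_smul_right, hαα]
  module

theorem reflection_eq_iff (hα : α ∈ cs.roots) (hr : ∀ x, r x = x - (2 * (⟪α, x⟫_ℝ - c)) • α)
    (x : ModelSpace n) : r x = x ↔ ⟪α, x⟫_ℝ = c := by
  have h0 : α ≠ 0 := fun h => by have := hα.1; simp [h] at this
  rw [hr, sub_eq_self, smul_eq_zero, or_iff_left h0]
  constructor <;> intro h <;> linarith

theorem isModelWall_iff :
    cs.IsModelWall M ↔ ∃ α ∈ cs.roots, ∃ c : ℝ, M = {x | ⟪α, x⟫_ℝ = c} := by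
  constructor
  · rintro ⟨r, hr, rfl⟩
    obtain ⟨α, hα, c, h⟩ := IsAffineReflection.exists_root cs hr
    exact ⟨α, hα, c, by ext x; exact cs.reflection_eq_iff hα h x⟩
  · rintro ⟨α, hα, c, rfl⟩
    obtain ⟨r, hr, h⟩ := cs.exists_isAffineReflection hα c
    exact ⟨r, hr, by ext x; exact (cs.reflection_eq_iff hα h x).symm⟩

theorem isModelHalf_halfSpace (hα : α ∈ cs.roots) (c : ℝ) :
    cs.IsModelHalf {x | ⟪α, x⟫_ℝ = c} {x | c ≤ ⟪α, x⟫_ℝ} := by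
  obtain ⟨r, hr, h⟩ := cs.exists_isAffineReflection hα c
  have hin : ∀ x, ⟪α, r x⟫_ℝ = 2 * c - ⟪α, x⟫_ℝ := fun x => by
    rw [h, inner_sub_right, inner_smul_right, cs.inner_root_self hα]; ring
  have hrr : ∀ x, r (r x) = x := fun x => by rw [h (r x), hin, h]; module
  have him : ⇑r '' {x | c ≤ ⟪α, x⟫_ℝ} = {x | ⟪α, x⟫_ℝ ≤ c} := by
    ext x
    constructor
    · rintro ⟨y, hy, rfl⟩
      simp only [mem_ofPred_eq] at hy ⊢
      rw [hin]; linarith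
    · intro hx
      simp only [mem_ofPred_eq] at hx
      exact ⟨r x, by simp only [mem_ofPred_eq]; rw [hin]; linarith, hrr x⟩
  refine ⟨r, hr, by ext x; exact (cs.reflection_eq_iff hα h x).symm,
    isClosed_le continuous_const (by fun_prop), ?_, ?_, ?_⟩
  · exact convex_halfSpace_ge (innerSL ℝ α).toLinearMap.isLinear c
  · rw [him]; ext x; simpa using le_total c _
  · rw [him]; ext x; simp only [mem_inter_iff, mem_ofPred_eq]
    exact ⟨fun hx => le_antisymm hx.2 hx.1, fun hx => ⟨hx.ge, hx.le⟩⟩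

theorem IsModelHalf.exists_root (hH : cs.IsModelHalf M H) : ∃ α ∈ cs.roots, ∃ c : ℝ,
    M = {x | ⟪α, x⟫_ℝ = c} ∧ H ⊆ {x | c ≤ ⟪α, x⟫_ℝ} := by
  obtain ⟨r, hr, hM, _, hconv, _, hinter⟩ := hH
  obtain ⟨α, hα, c, h⟩ := IsAffineReflection.exists_root cs hr
  have hM' : M = {x | ⟪α, x⟫_ℝ = c} := by
    rw [hM]; ext x; exact cs.reflection_eq_iff hα h x
  have hin : ∀ x, ⟪α, r x⟫_ℝ = 2 * c - ⟪α, x⟫_ℝ := fun x => by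
    rw [h, inner_sub_right, inner_smul_right, cs.inner_root_self hα]; ring
  have hrr : ∀ x, r (r x) = x := fun x => by rw [h (r x), hin, h]; module
  have hMH : ∀ x, ⟪α, x⟫_ℝ = c → x ∈ H := fun x hx => by
    have : x ∈ M := by rw [hM']; exact hx
    rw [← hinter] at this
    exact this.1
  have hnot : ∀ x ∈ H, r x ∈ H → ⟪α, x⟫_ℝ = c := fun x hx hrx => by
    have : x ∈ M := by rw [← hinter]; exact ⟨hx, r x, hrx, hrr x⟩
    rwa [hM'] at this
  have hside : ∀ y₁ ∈ H, ∀ y₂ ∈ H, c < ⟪α, y₁⟫_ℝ → c ≤ ⟪α, y₂⟫_ℝ := by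
    intro y₁ h₁ y₂ h₂ hlt
    by_contra! hlt'
    set a := ⟪α, y₁⟫_ℝ - c with ha
    set b := c - ⟪α, y₂⟫_ℝ with hb
    have ha0 : 0 < a := by linarith
    have hb0 : 0 < b := by linarith
    set s := a / (a + b) with hs
    set t := b / (a + b) with ht
    have hst : t + s = 1 := by rw [hs, ht]; field_simp; ring
    have hs0 : 0 < s := by positivity
    have ht0 : 0 < t := by positivity
    have hsb : s * b = t * a := by rw [hs, ht]; field_simp
    set m := y₁ - a • α with hm
    have hαα := cs.inner_root_self hα
    have hmc : ⟪α, m⟫_ℝ = c := by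
      rw [hm, inner_sub_right, inner_smul_right, hαα, ha]; ring
    set z := s • m + t • y₁ with hz
    have hzH : z ∈ H := hconv (hMH m hmc) h₁ hs0.le ht0.le (by linarith)
    have hzc : ⟪α, z⟫_ℝ = c + t * a := by
      rw [hz, inner_add_right, inner_smul_right, inner_smul_right, hmc,
        show ⟪α, y₁⟫_ℝ = c + a by rw [ha]; ring]
      linear_combination c * hst
    set m' := t⁻¹ • (r z - s • y₂) with hm'
    have hm'c : ⟪α, m'⟫_ℝ = c := by
      rw [hm', inner_smul_right, inner_sub_right, inner_smul_right, hin, hzc,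
        show ⟪α, y₂⟫_ℝ = c - b by rw [hb]; ring, inv_mul_eq_iff_eq_mul₀ ht0.ne']
      linear_combination -c * hst + hsb
    have hrz : r z ∈ H := by
      have := hconv (hMH m' hm'c) h₂ ht0.le hs0.le hst
      rwa [hm', smul_inv_smul₀ ht0.ne', sub_add_cancel] at this
    have := hnot z hzH hrz
    rw [hzc] at this
    have := mul_pos ht0 ha0
    linarith
  by_cases hex : ∃ y₁ ∈ H, c < ⟪α, y₁⟫_ℝ
  · obtain ⟨y₁, h₁, hlt⟩ := hex
    exact ⟨α, hα, c, hM', fun y hy => hside y₁ h₁ y hy hlt⟩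
  · push Not at hex
    refine ⟨-α, cs.neg_mem_roots hα, -c, ?_, fun y hy => ?_⟩
    · rw [hM']; ext x; simp
    · simpa using hex y hy

end SphericalCoxeterSystem

namespace SphericalCoxeterSystem

open WeylAtlas
open scoped InnerProductSpace

variable {n : ℕ} (cs : SphericalCoxeterSystem n) {u v x y α β : ModelSpace n} {c : ℝ}
  {w r : ModelSpace n ≃ᵢ ModelSpace n} {M H F : Set (ModelSpace n)}

theorem root_ne_zero (hα : α ∈ cs.roots) : α ≠ 0 := fun h => by
  have := hα.1
  simp [h] at this

theorem IsModelSectorFace.exists_sign (hF : cs.IsModelSectorFace x F) (hα : α ∈ cs.roots) :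
    (∀ y ∈ F, 0 ≤ ⟪α, y - x⟫_ℝ) ∨ ∀ y ∈ F, ⟪α, y - x⟫_ℝ ≤ 0 := by
  obtain ⟨-, σ, hσ, rfl⟩ := hF
  have hM : cs.IsModelWall {y | ⟪α, y⟫_ℝ = ⟪α, x⟫_ℝ} := cs.isModelWall_iff.2 ⟨α, hα, _, rfl⟩
  have hsub : ∀ y ∈ ⋂ M ∈ {M | cs.IsModelWall M ∧ x ∈ M}, σ M,
      y ∈ σ {y | ⟪α, y⟫_ℝ = ⟪α, x⟫_ℝ} := fun y hy => mem_iInter₂.1 hy _ ⟨hM, rfl⟩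
  rcases hσ _ hM rfl with h | h
  · left
    intro y hy
    have := hsub y hy
    rw [h] at this
    rw [inner_sub_right, this, sub_self]
  · obtain ⟨β, hβ, c, hMβ, hH⟩ := IsModelHalf.exists_root cs h
    have hx : ⟪β, x⟫_ℝ = c := by
      have : x ∈ {y | ⟪α, y⟫_ℝ = ⟪α, x⟫_ℝ} := rfl
      rwa [hMβ] at this
    have hpos : ∀ y ∈ ⋂ M ∈ {M | cs.IsModelWall M ∧ x ∈ M}, σ M, 0 ≤ ⟪β, y - x⟫_ℝ := by
      intro y hy
      rw [inner_sub_right, hx]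
      exact sub_nonneg.2 (hH (hsub y hy))
    have hβα : β = α ∨ β = -α := eq_or_eq_neg_of_forall_inner hα.1 hβ.1 fun y hy => by
      have : x + y ∈ {y | ⟪α, y⟫_ℝ = ⟪α, x⟫_ℝ} := by
        rw [mem_ofPred_eq, inner_add_right, hy, add_zero]
      rw [hMβ, mem_ofPred_eq, inner_add_right, hx] at this
      linarith
    rcases hβα with rfl | rfl
    · exact Or.inl hpos
    · right
      intro y hy
      have := hpos y hy
      rw [inner_neg_left] at this
      linarith

theorem exists_regular_near (v : ModelSpace n) :
    ∃ u, (∀ α ∈ cs.roots, ⟪α, u⟫_ℝ ≠ 0) ∧ ∀ α ∈ cs.roots, 0 < ⟪α, v⟫_ℝ → 0 < ⟪α, u⟫_ℝ := by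
  have hopen : IsOpen {u : ModelSpace n | ∀ α ∈ cs.roots, 0 < ⟪α, v⟫_ℝ → 0 < ⟪α, u⟫_ℝ} := by
    have : {u : ModelSpace n | ∀ α ∈ cs.roots, 0 < ⟪α, v⟫_ℝ → 0 < ⟪α, u⟫_ℝ}
        = ⋂ α ∈ cs.roots, {u | 0 < ⟪α, v⟫_ℝ → 0 < ⟪α, u⟫_ℝ} := by
      ext u; simp
    rw [this]
    refine cs.finite_roots.isOpen_biInter fun α _ => ?_
    by_cases h : 0 < ⟪α, v⟫_ℝ
    · simp only [h, true_imp_iff]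
      exact isOpen_lt continuous_const (by fun_prop)
    · simp [h]
  obtain ⟨u, hu, hu'⟩ := (dense_inner_ne_zero cs.finite_roots
    fun α hα => cs.root_ne_zero hα).inter_open_nonempty _ hopen ⟨v, fun _ _ h => h⟩
  exact ⟨u, hu', hu⟩

theorem IsModelSectorFace.exists_subset_chamber (hF : cs.IsModelSectorFace x F) :
    ∃ u, (∀ α ∈ cs.roots, ⟪α, u⟫_ℝ ≠ 0) ∧ ∀ y ∈ F, y - x ∈ chamber cs.roots u := by
  have hex : ∀ α, ∃ y, (∃ z ∈ F, y = z - x) ∧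
      (α ∈ cs.roots → (∃ z ∈ F, 0 < ⟪α, z - x⟫_ℝ) → 0 < ⟪α, y⟫_ℝ) := by
    intro α
    by_cases h : ∃ z ∈ F, 0 < ⟪α, z - x⟫_ℝ
    · obtain ⟨z, hz, h⟩ := h
      exact ⟨_, ⟨z, hz, rfl⟩, fun _ _ => h⟩
    · obtain ⟨z, hz⟩ := hF.1
      exact ⟨_, ⟨z, hz, rfl⟩, fun _ h' => absurd h' h⟩
  choose Y hY hY' using hex
  obtain ⟨u, hu, huv⟩ := cs.exists_regular_near (∑ β ∈ cs.finite_roots.toFinset, Y β)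
  refine ⟨u, hu, fun y hy α hα hpos => ?_⟩
  rcases IsModelSectorFace.exists_sign cs hF hα with h | h
  · exact h y hy
  · by_contra! hlt
    have h1 : 0 < ⟪-α, ∑ β ∈ cs.finite_roots.toFinset, Y β⟫_ℝ := by
      rw [inner_sum]
      refine Finset.sum_pos' (fun β _ => ?_) ⟨-α, ?_, ?_⟩
      · obtain ⟨z, hz, hzY⟩ := hY β
        rw [hzY, inner_neg_left]
        linarith [h z hz]
      · exact cs.finite_roots.mem_toFinset.2 (cs.neg_mem_roots hα)
      · exact hY' _ (cs.neg_mem_roots hα) ⟨y, hy, by rw [inner_neg_left]; linarith⟩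
    have := huv _ (cs.neg_mem_roots hα) h1
    rw [inner_neg_left] at this
    linarith

theorem chamber_eq_of_mem (hu : ∀ α ∈ cs.roots, ⟪α, u⟫_ℝ ≠ 0)
    (hv : ∀ α ∈ cs.roots, ⟪α, v⟫_ℝ ≠ 0) (huv : u ∈ chamber cs.roots v) :
    chamber cs.roots v = chamber cs.roots u := by
  have key : ∀ α ∈ cs.roots, (0 < ⟪α, v⟫_ℝ ↔ 0 < ⟪α, u⟫_ℝ) := fun α hα => by
    refine ⟨fun h => lt_of_le_of_ne (huv α hα h) (hu α hα).symm, fun h => ?_⟩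
    by_contra! h'
    have := huv _ (cs.neg_mem_roots hα)
      (by rw [inner_neg_left]; linarith [lt_of_le_of_ne h' (hv α hα)])
    rw [inner_neg_left] at this
    linarith
  ext y
  exact forall₂_congr fun α hα => by rw [key α hα]

theorem isModelSectorFace_chamber (hu : ∀ α ∈ cs.roots, ⟪α, u⟫_ℝ ≠ 0) (x : ModelSpace n) :
    cs.IsModelSectorFace x {y | y - x ∈ chamber cs.roots u} := by
  set σ : Set (ModelSpace n) → Set (ModelSpace n) := fun M =>
    {y | ∀ α ∈ cs.roots, 0 < ⟪α, u⟫_ℝ → M = {z | ⟪α, z⟫_ℝ = ⟪α, x⟫_ℝ} → ⟪α, x⟫_ℝ ≤ ⟪α, y⟫_ℝ}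
    with hσ
  have hwall : ∀ M, cs.IsModelWall M → x ∈ M →
      ∃ α ∈ cs.roots, 0 < ⟪α, u⟫_ℝ ∧ M = {z | ⟪α, z⟫_ℝ = ⟪α, x⟫_ℝ} := by
    intro M hM hx
    obtain ⟨α, hα, c, rfl⟩ := cs.isModelWall_iff.1 hM
    rw [mem_ofPred_eq] at hx
    subst hx
    rcases lt_or_gt_of_ne (hu α hα) with h | h
    · refine ⟨-α, cs.neg_mem_roots hα, by rw [inner_neg_left]; linarith, ?_⟩
      ext z
      simp
    · exact ⟨α, hα, h, rfl⟩
  refine ⟨⟨x, by simpa using zero_mem_chamber⟩, σ, fun M hM hx => Or.inr ?_, ?_⟩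
  · obtain ⟨α, hα, hpos, rfl⟩ := hwall M hM hx
    have : σ {z | ⟪α, z⟫_ℝ = ⟪α, x⟫_ℝ} = {y | ⟪α, x⟫_ℝ ≤ ⟪α, y⟫_ℝ} := by
      ext y
      refine ⟨fun h => h α hα hpos rfl, fun h β hβ hβpos hβM => ?_⟩
      have hβα : β = α ∨ β = -α := eq_or_eq_neg_of_forall_inner hα.1 hβ.1 fun z hz => by
        have : x + z ∈ {z | ⟪α, z⟫_ℝ = ⟪α, x⟫_ℝ} := by
          rw [mem_ofPred_eq, inner_add_right, hz, add_zero]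
        rw [hβM, mem_ofPred_eq, inner_add_right] at this
        linarith
      rcases hβα with rfl | rfl
      · exact h
      · rw [inner_neg_left] at hβpos
        linarith
    rw [this]
    exact cs.isModelHalf_halfSpace hα _
  · ext y
    simp only [mem_ofPred_eq, mem_iInter]
    constructor
    · intro h M _ α hα hpos _
      have := h α hα hpos
      rw [inner_sub_right] at this
      linarith
    · intro h α hα hpos
      rw [inner_sub_right]
      exact sub_nonneg.2 (h _ ⟨cs.isModelWall_iff.2 ⟨α, hα, _, rfl⟩, rfl⟩ α hα hpos rfl)

theorem isModelSector_chamber (hu : ∀ α ∈ cs.roots, ⟪α, u⟫_ℝ ≠ 0) (x : ModelSpace n) :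
    cs.IsModelSector x {y | y - x ∈ chamber cs.roots u} := by
  refine ⟨cs.isModelSectorFace_chamber hu x, fun F hF hsub => hsub.antisymm' fun y hy => ?_⟩
  obtain ⟨v, hv, hFv⟩ := IsModelSectorFace.exists_subset_chamber cs hF
  have huv : u ∈ chamber cs.roots v := by
    have := hFv (x + u) (hsub (by simpa using self_mem_chamber))
    rwa [add_sub_cancel_left] at this
  rw [mem_ofPred_eq, ← cs.chamber_eq_of_mem hu hv huv]
  exact hFv y hy

theorem IsModelSector.exists_eq_chamber (hF : cs.IsModelSector x F) :
    ∃ u, (∀ α ∈ cs.roots, ⟪α, u⟫_ℝ ≠ 0) ∧ F = {y | y - x ∈ chamber cs.roots u} := by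
  obtain ⟨u, hu, hFu⟩ := IsModelSectorFace.exists_subset_chamber cs hF.1
  exact ⟨u, hu, (hF.2 _ (cs.isModelSectorFace_chamber hu x) hFu).symm⟩

end SphericalCoxeterSystem

namespace RBuilding

open WeylAtlas
open scoped InnerProductSpace

variable {n : ℕ} {cs : SphericalCoxeterSystem n} {X : Type*} [MetricSpace X] {Λ : Set X}
  (B : RBuilding cs X Λ) {f g h : ModelSpace n → X} {u v : ModelSpace n} {T : Set X}

theorem exists_transition (hf : f ∈ B.charts) (hg : g ∈ B.charts) :
    ∃ L ∈ cs.linearGroup, ∃ τ, ∀ x, f x ∈ range g → f x = g (L x + τ) := by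
  obtain ⟨-, -, w, hw, h⟩ := B.A2 f hf g hg
  obtain ⟨L, hL, τ, hτ⟩ := cs.exists_eq_add_of_mem_W hw
  exact ⟨L, hL, τ, fun x hx => by rw [h x hx, hτ]⟩

theorem isSector_image_chamber (hf : f ∈ B.charts) (hu : ∀ α ∈ cs.roots, ⟪α, u⟫_ℝ ≠ 0) :
    IsSector cs B.charts (f '' chamber cs.roots u) := by
  refine ⟨f 0, f, hf, 0, _, cs.isModelSector_chamber hu 0, rfl, ?_⟩
  simp

theorem exists_subchamber (hf : f ∈ B.charts) (hh : h ∈ B.charts)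
    (hu : ∀ α ∈ cs.roots, ⟪α, u⟫_ℝ ≠ 0) (hT : IsSector cs B.charts T)
    (hTf : T ⊆ f '' chamber cs.roots u) (hTh : T ⊆ range h) :
    ∃ L ∈ cs.linearGroup, ∃ p p', ∀ x ∈ chamber cs.roots u, f (p + x) = h (p' + L x) := by
  obtain ⟨-, k, hk, y, s, hs, -, rfl⟩ := hT
  obtain ⟨v, hv, rfl⟩ := SphericalCoxeterSystem.IsModelSector.exists_eq_chamber cs hs
  obtain ⟨L, hL, τ, hkf⟩ := B.exists_transition hk hf
  have hmem : ∀ z ∈ chamber cs.roots v, L (y + z) + τ ∈ chamber cs.roots u := by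
    intro z hz
    have hz' : y + z ∈ {x | x - y ∈ chamber cs.roots v} := by
      rwa [mem_ofPred_eq, add_sub_cancel_left]
    obtain ⟨z', hz', h'⟩ := hTf (mem_image_of_mem k hz')
    rw [hkf _ ⟨z', h'⟩] at h'
    rwa [← (B.isom f hf).injective h']
  have hsymm : ∀ z, L (L.symm z) = z := L.apply_symm_apply
  have hLinv : L.symm ∈ cs.linearGroup := cs.linearGroup.inv_mem hL
  have hreg : ∀ α ∈ cs.roots, ⟪α, L v⟫_ℝ ≠ 0 := by
    intro α hα
    rw [← hsymm α, L.inner_map_map]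
    exact hv _ (cs.map_mem_roots hLinv hα)
  have hLv : L v ∈ chamber cs.roots u := by
    have hray : ∀ t : ℝ, 0 ≤ t → L y + τ + t • L v ∈ chamber cs.roots u := by
      intro t ht
      have := hmem (t • v) (smul_mem_chamber ht self_mem_chamber)
      rw [map_add, map_smul] at this
      convert this using 1
      abel
    have := add_mem_of_ray isClosed_chamber convex_chamber hray zero_mem_chamber
    rwa [zero_add] at this
  have hsub : ∀ x ∈ chamber cs.roots u, L.symm x ∈ chamber cs.roots v := by
    rw [cs.chamber_eq_of_mem hreg hu hLv]
    intro x hx α hα hpos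
    have := hx (L α) (cs.map_mem_roots hL hα) (by rwa [L.inner_map_map])
    rwa [← hsymm x, L.inner_map_map] at this
  obtain ⟨L', hL', τ', hfh⟩ := B.exists_transition hf hh
  refine ⟨L', hL', L y + τ, L' (L y + τ) + τ', fun x hx => ?_⟩
  have hx' : y + L.symm x ∈ {x | x - y ∈ chamber cs.roots v} := by
    rw [mem_ofPred_eq, add_sub_cancel_left]
    exact hsub x hx
  have h1 : k (y + L.symm x) = f (L y + τ + x) := by
    obtain ⟨z', -, h'⟩ := hTf (mem_image_of_mem k hx')
    rw [hkf _ ⟨z', h'⟩, map_add, hsymm]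
    congr 1
    abel
  have h2 := hTh (mem_image_of_mem k hx')
  rw [h1] at h2
  rw [hfh _ h2, map_add]
  congr 1
  abel

theorem exists_common_chart (hf : f ∈ B.charts) (hg : g ∈ B.charts)
    (hu : ∀ α ∈ cs.roots, ⟪α, u⟫_ℝ ≠ 0) (hv : ∀ α ∈ cs.roots, ⟪α, v⟫_ℝ ≠ 0) :
    ∃ h ∈ B.charts, ∃ L ∈ cs.linearGroup, ∃ p p' q q',
      (∀ x ∈ chamber cs.roots u, f (p + x) = h (p' + x)) ∧
      (∀ x ∈ chamber cs.roots v, g (q + x) = h (q' + L x)) := by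
  obtain ⟨T₁, T₂, h, hh, hT₁, hT₂, h₁, h₂, h₁', h₂'⟩ := B.A4 _ _
    (B.isSector_image_chamber hf hu) (B.isSector_image_chamber hg hv)
  obtain ⟨L₁, hL₁, p, p', hp⟩ := B.exists_subchamber hf hh hu hT₁ h₁ h₁'
  obtain ⟨L₂, hL₂, q, q', hq⟩ := B.exists_subchamber hg hh hv hT₂ h₂ h₂'
  refine ⟨_, B.A1 h hh L₁.toIsometryEquiv (cs.Wbar_le_W hL₁), L₁⁻¹ * L₂,
    cs.linearGroup.mul_mem (cs.linearGroup.inv_mem hL₁) hL₂, p, L₁.symm p', q, L₁.symm q',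
    fun x hx => ?_, fun x hx => ?_⟩
  · rw [hp x hx]
    change _ = h (L₁ (L₁.symm p' + x))
    rw [map_add, L₁.apply_symm_apply]
  · rw [hq x hx]
    change _ = h (L₁ (L₁.symm q' + L₁.symm (L₂ x)))
    rw [map_add, L₁.apply_symm_apply, L₁.apply_symm_apply]

/-- The atlas of an `ℝ`-building. -/
def toWeylAtlas : WeylAtlas (ModelSpace n) X where
  charts := B.charts
  group := cs.linearGroup
  roots := cs.roots
  isometry := B.isom
  finite_group := cs.finite_linearGroup
  finite_roots := cs.finite_roots
  norm_root _ hα := hα.1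
  neg_root _ hα := cs.neg_mem_roots hα
  refl_mem := by
    rintro α ⟨-, s, hs, w, hw, h⟩
    obtain ⟨L, hL, hLw⟩ := cs.exists_mem_linearGroup
      (cs.Wbar.mul_mem (cs.Wbar.mul_mem hw (Subgroup.subset_closure hs)) (cs.Wbar.inv_mem hw))
    exact ⟨L, hL, fun x => by rw [hLw, h]⟩
  comp_mem f hf L hL := B.A1 f hf L.toIsometryEquiv (cs.Wbar_le_W hL)
  isClosed_preimage f hf g hg := (B.A2 f hf g hg).1
  convex_preimage f hf g hg := (B.A2 f hf g hg).2.1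
  exists_transition _ hf _ hg := B.exists_transition hf hg
  exists_common_chart _ hf _ hg _ _ hu hv := B.exists_common_chart hf hg hu hv
  inter_nonempty := by
    have key : ∀ s : Set X, (∃ f ∈ B.charts, ∃ α ∈ cs.roots, ∃ c : ℝ,
        s = f '' {x | c ≤ ⟪α, x⟫_ℝ}) → IsHalfApartment cs B.charts s := by
      rintro s ⟨f, hf, α, hα, c, rfl⟩
      exact ⟨f, hf, _, _, cs.isModelHalf_halfSpace hα c, rfl⟩
    exact fun f₁ h₁ f₂ h₂ f₃ h₃ h₁₂ h₂₃ h₁₃ =>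
      B.A5 f₁ h₁ f₂ h₂ f₃ h₃ (key _ h₁₂) (key _ h₂₃) (key _ h₁₃)

end RBuilding

/-- A continuous function with nondecreasing slopes at every point of an open interval lies below
its chord. -/
theorem le_chord_of_slopes {ψ : ℝ → ℝ} (hψ : Continuous ψ)
    (h : ∀ t ∈ Ioo (0 : ℝ) 1, ∃ s > 0, ∃ c c' : ℝ, c ≤ c' ∧ ∀ r ∈ Icc 0 s,
      ψ (t + r) = ψ t + c' * r ∧ ψ (t - r) = ψ t - c * r) {t : ℝ} (ht : t ∈ Icc (0 : ℝ) 1) :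
    ψ t ≤ (1 - t) * ψ 0 + t * ψ 1 := by
  set χ : ℝ → ℝ := fun t => ψ t - ((1 - t) * ψ 0 + t * ψ 1) with hχ
  have hχc : Continuous χ := by fun_prop
  have h0 : χ 0 = 0 := by simp [hχ]
  have h1 : χ 1 = 0 := by simp [hχ]
  obtain ⟨m, hm, hmax⟩ := isCompact_Icc.exists_isMaxOn (nonempty_Icc.2 zero_le_one) hχc.continuousOn
  have hle : ∀ r ∈ Icc (0 : ℝ) 1, χ r ≤ χ m := fun r hr => hmax hr
  suffices χ m ≤ 0 by
    have := hle t ht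
    simp only [hχ] at this
    linarith
  by_contra! hpos
  have hcomp : IsCompact (Icc (0 : ℝ) 1 ∩ χ ⁻¹' {χ m}) :=
    isCompact_Icc.inter_right (isClosed_singleton.preimage hχc)
  obtain ⟨l, ⟨hl, hlm⟩, hleast⟩ := hcomp.exists_isLeast ⟨m, hm, rfl⟩
  replace hlm : χ l = χ m := hlm
  have hl0 : 0 < l := lt_of_le_of_ne hl.1 fun h => by rw [← h, h0] at hlm; linarith
  have hl1 : l < 1 := lt_of_le_of_ne hl.2 fun h => by rw [h, h1] at hlm; linarith
  obtain ⟨s, hs, c, c', hcc, hslope⟩ := h l ⟨hl0, hl1⟩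
  set r := min s (min l (1 - l)) with hr
  have hr0 : 0 < r := lt_min hs (lt_min hl0 (by linarith))
  have hrl : r ≤ l := (min_le_right _ _).trans (min_le_left _ _)
  have hrl' : r ≤ 1 - l := (min_le_right _ _).trans (min_le_right _ _)
  obtain ⟨hp, hm'⟩ := hslope r ⟨hr0.le, min_le_left _ _⟩
  have hp' : χ (l + r) = χ l + (c' - (ψ 1 - ψ 0)) * r := by
    simp only [hχ, hp]; ring
  have hn' : χ (l - r) = χ l - (c - (ψ 1 - ψ 0)) * r := by
    simp only [hχ, hm']; ring
  have h2 := hle (l + r) ⟨by linarith, by linarith⟩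
  have h3 := hle (l - r) ⟨by linarith, by linarith⟩
  have h4 : (c' - (ψ 1 - ψ 0)) * r ≤ 0 := by linarith
  have h5 : (c - (ψ 1 - ψ 0)) * r ≤ (c' - (ψ 1 - ψ 0)) * r := by gcongr
  have := hleast ⟨⟨by linarith, by linarith⟩, (by linarith : χ (l - r) = χ m)⟩
  linarith

namespace WeylAtlas

open scoped InnerProductSpace

variable {E X : Type*} [NormedAddCommGroup E] [InnerProductSpace ℝ E] [MetricSpace X]
  (A : WeylAtlas E X) {f g h k : E → X}

theorem dist_chart (hf : f ∈ A.charts) (x y : E) : dist (f x) (f y) = ‖x - y‖ := by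
  rw [(A.isometry f hf).dist_eq, dist_eq_norm]

theorem exists_germ_data [CompleteSpace E] (hf : f ∈ A.charts) (hk : k ∈ A.charts) {a₀ a₁ : E}
    (ha : k a₁ = f a₀) (d z : E) :
    ∃ g ∈ A.charts, ∃ s > (0 : ℝ), ∃ a b e : E, g b = k z ∧ ‖e‖ = ‖d‖ ∧
      ∀ t ∈ Icc 0 s, f (a₀ + t • d) = g (a + t • e) := by
  obtain ⟨g, hg, ⟨b, hb⟩, s, hs, hrange⟩ := A.exists_chart_segment_germ hf hk ha d z
  obtain ⟨L, -, τ, h⟩ := A.exists_transition f hf g hg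
  refine ⟨g, hg, s, hs, L a₀ + τ, b, L d, hb, L.norm_map d, fun t ht => ?_⟩
  rw [h _ (hrange t ht), map_add, map_smul]
  congr 1
  abel

theorem segment_eq (hg : g ∈ A.charts) (hh : h ∈ A.charts) {a b a' b' : E}
    (ha : g a = h a') (hb : g b = h b') {r : ℝ} (hr : r ∈ Icc (0 : ℝ) 1) :
    g (a + r • (b - a)) = h (a' + r • (b' - a')) := by
  obtain ⟨L, -, τ, htr⟩ := A.exists_transition g hg h hh
  have hinj := (A.isometry h hh).injective
  have ha' : a' = L a + τ := hinj (by rw [← ha, htr a ⟨a', ha.symm⟩])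
  have hb' : b' = L b + τ := hinj (by rw [← hb, htr b ⟨b', hb.symm⟩])
  have hmem : a + r • (b - a) ∈ {x | g x ∈ range h} :=
    (A.convex_preimage g hg h hh).add_smul_sub_mem ⟨a', ha.symm⟩ ⟨b', hb.symm⟩ hr
  rw [htr _ hmem, ha', hb', map_add, map_smul, map_sub]
  congr 1
  module

theorem inner_add_inner_nonpos (hg : g ∈ A.charts) (hh : h ∈ A.charts) {a b a' b' e e' : E}
    (ha : g a = h a') (hb : g b = h b') {s : ℝ} (hs : 0 < s) (he : ‖e'‖ = ‖e‖)
    (hd : dist (g (a + s • e)) (h (a' + s • e')) = 2 * s * ‖e‖) :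
    ⟪b - a, e⟫_ℝ + ⟪b' - a', e'⟫_ℝ ≤ 0 := by
  rcases eq_or_ne e 0 with h0 | h0
  · have : e' = 0 := by rw [← norm_eq_zero, he, h0, norm_zero]
    simp [h0, this]
  have hl : 0 < s * ‖e‖ := mul_pos hs (norm_pos_iff.2 h0)
  set σ := ⟪b - a, e⟫_ℝ + ⟪b' - a', e'⟫_ℝ with hσ
  set D := ‖b - a‖ ^ 2 + ‖b' - a'‖ ^ 2 with hD
  have hD0 : 0 ≤ D := by positivity
  have hbound : ∀ (B y : E) (r : ℝ), ‖y‖ = ‖e‖ → 2 * (s * ‖e‖) * ‖s • y - r • B‖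
      ≤ 2 * (s * ‖e‖) ^ 2 - 2 * s * r * ⟪B, y⟫_ℝ + r ^ 2 * ‖B‖ ^ 2 := by
    intro B y r hy
    have h1 := norm_sub_sq_real (s • y) (r • B)
    rw [norm_smul, norm_smul, inner_smul_left, inner_smul_right, hy, mul_pow, mul_pow,
      Real.norm_eq_abs, Real.norm_eq_abs, sq_abs, sq_abs, real_inner_comm] at h1
    simp only [conj_trivial] at h1
    nlinarith [sq_nonneg (‖s • y - r • B‖ - s * ‖e‖)]
  have key : ∀ r ∈ Icc (0 : ℝ) 1, 2 * s * r * σ ≤ r ^ 2 * D := by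
    intro r hr
    have h1 := dist_triangle_right (g (a + s • e)) (h (a' + s • e')) (g (a + r • (b - a)))
    rw [A.dist_chart hg, A.segment_eq hg hh ha hb hr, A.dist_chart hh, hd, add_sub_add_left_eq_sub,
      add_sub_add_left_eq_sub] at h1
    have h2 := hbound (b - a) e r rfl
    have h3 := hbound (b' - a') e' r he
    have h4 := mul_le_mul_of_nonneg_left h1 (by positivity : 0 ≤ 2 * (s * ‖e‖))
    rw [hσ, hD]
    nlinarith
  by_contra! hpos
  set r := min 1 (s * σ / (D + 1)) with hr
  have hr0 : 0 < r := lt_min one_pos (by positivity)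
  have h1 := key r ⟨hr0.le, min_le_left _ _⟩
  have h2 : r * (D + 1) ≤ s * σ := (le_div_iff₀ (by positivity)).1 (min_le_right _ _)
  nlinarith [mul_pos hs hpos]

/-- The comparison inequality for a vertex and a segment contained in a chart. -/
theorem sq_dist_le [CompleteSpace E] (hf : f ∈ A.charts) {Z : X}
    (hZ : ∀ a, ∃ k ∈ A.charts, f a ∈ range k ∧ Z ∈ range k) (x y : E) {t : ℝ}
    (ht : t ∈ Icc (0 : ℝ) 1) : dist Z (f (x + t • (y - x))) ^ 2 ≤
      (1 - t) * dist Z (f x) ^ 2 + t * dist Z (f y) ^ 2 - t * (1 - t) * ‖y - x‖ ^ 2 := by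
  set d := y - x with hd
  have hfc : Continuous f := (A.isometry f hf).continuous
  have := le_chord_of_slopes (ψ := fun t => dist Z (f (x + t • d)) ^ 2 - t ^ 2 * ‖d‖ ^ 2)
    (by fun_prop) ?_ ht
  · simp only [zero_smul, add_zero, one_smul] at this
    rw [show x + d = y by rw [hd]; abel] at this
    linarith
  intro t₀ _
  obtain ⟨k, hk, ⟨a₁, ha₁⟩, z, hz⟩ := hZ (x + t₀ • d)
  obtain ⟨g, hg, s, hs, a, b, e, hb, he, hge⟩ := A.exists_germ_data hf hk ha₁ d z
  obtain ⟨h, hh, s', hs', a', b', e', hb', he', hhe⟩ := A.exists_germ_data hf hk ha₁ (-d) z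
  rw [norm_neg] at he'
  have key : ∀ {g : E → X}, g ∈ A.charts → ∀ {a b e v : E} {r : ℝ}, g b = k z → ‖e‖ = ‖d‖ →
      f v = g (a + r • e) → dist Z (f v) ^ 2 = ‖b - a‖ ^ 2 - 2 * r * ⟪b - a, e⟫_ℝ
        + r ^ 2 * ‖d‖ ^ 2 := by
    intro g hg a b e v r hb he hv
    rw [hv, ← hz, ← hb, A.dist_chart hg, show b - (a + r • e) = b - a - r • e by abel,
      norm_sub_sq_real, inner_smul_right, norm_smul, he, mul_pow, Real.norm_eq_abs, sq_abs]
    ring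
  set S := min s s' with hS
  have hS0 : 0 < S := lt_min hs hs'
  have hgS := hge S ⟨hS0.le, min_le_left _ _⟩
  have hhS := hhe S ⟨hS0.le, min_le_right _ _⟩
  have hg0 := hge 0 ⟨le_rfl, hs.le⟩
  have hh0 := hhe 0 ⟨le_rfl, hs'.le⟩
  have hga := key hg hb he hg0
  have hha := key hh hb' he' hh0
  simp only [zero_smul, add_zero] at hg0 hh0 hga hha
  refine ⟨S, hS0, 2 * ⟪b' - a', e'⟫_ℝ - 2 * t₀ * ‖d‖ ^ 2, -2 * ⟪b - a, e⟫_ℝ - 2 * t₀ * ‖d‖ ^ 2,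
    ?_, fun r hr => ⟨?_, ?_⟩⟩
  · have := A.inner_add_inner_nonpos hg hh (hg0.symm.trans hh0) (hb.trans hb'.symm) hS0
      (he'.trans he.symm) (by
        rw [← hgS, ← hhS, A.dist_chart hf, add_sub_add_left_eq_sub, smul_neg, sub_neg_eq_add,
          ← two_smul ℝ, smul_smul, norm_smul, he, Real.norm_of_nonneg (by positivity)])
    linarith
  · have h1 := hge r ⟨hr.1, hr.2.trans (min_le_left _ _)⟩
    rw [add_assoc, ← add_smul] at h1
    have h2 := key hg hb he h1
    simp only [h2, hga]
    ring
  · have h1 := hhe r ⟨hr.1, hr.2.trans (min_le_right _ _)⟩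
    rw [add_assoc, smul_neg, ← sub_eq_add_neg, ← sub_smul] at h1
    have h2 := key hh hb' he' h1
    simp only [h2, hha]
    ring

end WeylAtlas

theorem RBuilding.sq_dist_le {n : ℕ} {cs : SphericalCoxeterSystem n} {X : Type*} [MetricSpace X]
    {Λ : Set X} (B : RBuilding cs X Λ) {f : ModelSpace n → X} (hf : f ∈ B.charts) {Z : X}
    (hZ : Z ∈ Λ) (x y : ModelSpace n) {t : ℝ} (ht : t ∈ Icc (0 : ℝ) 1) :
    dist Z (f (x + t • (y - x))) ^ 2 ≤
      (1 - t) * dist Z (f x) ^ 2 + t * dist Z (f y) ^ 2 - t * (1 - t) * ‖y - x‖ ^ 2 :=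
  B.toWeylAtlas.sq_dist_le hf (fun a => B.A3 _ (B.into f hf (mem_range_self a)) _ hZ) x y ht

theorem sq_dist_segment {E : Type*} [NormedAddCommGroup E] [InnerProductSpace ℝ E] (x y z : E)
    (t : ℝ) : dist z (x + t • (y - x)) ^ 2 =
      (1 - t) * dist x z ^ 2 + t * dist y z ^ 2 - t * (1 - t) * dist x y ^ 2 := by
  rw [dist_comm x z, dist_comm y z, dist_comm x y]
  simp only [dist_eq_norm]
  rw [show z - (x + t • (y - x)) = (z - x) - t • (y - x) by abel,
    show z - y = (z - x) - (y - x) by abel, norm_sub_sq_real (z - x),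
    norm_sub_sq_real (z - x) (y - x), inner_smul_right, norm_smul, mul_pow, Real.norm_eq_abs,
    sq_abs]
  ring

/-- The metric space underlying an ℝ-building is a CAT(0) space. -/
theorem rBuilding_isCAT0
    {n : ℕ} (cs : SphericalCoxeterSystem n) {X : Type*} [MetricSpace X]
    {Λ : Set X} (B : RBuilding cs X Λ) :
    IsCAT0Space ↥Λ := by
  refine ⟨fun x y => ?_, ?_⟩
  · obtain ⟨f, hf, ⟨p, hp⟩, q, hq⟩ := B.A3 x x.2 y y.2
    have hdist : ∀ s t : ℝ, dist (f (p + s • (q - p))) (f (p + t • (q - p)))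
        = |s - t| * ‖q - p‖ := fun s t => by
      rw [(B.isom f hf).dist_eq, dist_eq_norm, add_sub_add_left_eq_sub, ← sub_smul, norm_smul,
        Real.norm_eq_abs]
    set l := ‖q - p‖ with hl
    refine ⟨_, 0, l, fun t => ⟨f (p + (t / l) • (q - p)), B.into f hf (mem_range_self _)⟩,
      norm_nonneg _, ?_, ?_, ?_, rfl⟩
    · exact Subtype.ext (by simpa using hp)
    · refine Subtype.ext ?_
      rcases eq_or_ne l 0 with h | h
      · have : q - p = 0 := norm_eq_zero.1 h
        simp [← hq, sub_eq_zero.1 this]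
      · simp [div_self h, hq]
    · intro s hs t ht
      rw [Subtype.dist_eq, hdist, ← sub_div, abs_div, abs_of_nonneg (norm_nonneg _ : 0 ≤ l)]
      rcases eq_or_ne l 0 with h | h
      · rw [h] at hs ht
        simp [le_antisymm hs.2 hs.1, le_antisymm ht.2 ht.1]
      · exact div_mul_cancel₀ _ h
  · rintro x y z _ ⟨u, v, γ, huv, rfl, rfl, hγ, rfl⟩ _ ⟨r, hr, rfl⟩ x' y' z' hxy hyz hxz a' ha' hxa
    obtain ⟨f, hf, ⟨p, hp⟩, q, hq⟩ := B.A3 _ (γ u).2 _ (γ v).2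
    rw [segment_eq_image'] at ha'
    obtain ⟨t, ht, rfl⟩ := ha'
    have hl : dist (γ u) (γ v) = ‖q - p‖ := by
      rw [Subtype.dist_eq, ← hp, ← hq, (B.isom f hf).dist_eq, dist_comm, dist_eq_norm]
    have h1 : dist (γ u) (γ r) = t * ‖q - p‖ := by
      rw [← hxa, ← hl, ← hxy, dist_self_add_right, norm_smul, Real.norm_of_nonneg ht.1,
        ← dist_eq_norm', dist_comm]
    have h2 : dist (γ r) (γ v) = (1 - t) * ‖q - p‖ := by
      have huI := left_mem_Icc.2 huv
      have hvI := right_mem_Icc.2 huv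
      rw [sub_mul, one_mul, ← h1, ← hl, hγ _ huI _ hvI, hγ _ huI _ hr, hγ _ hr _ hvI,
        abs_sub_comm u v, abs_sub_comm u r, abs_sub_comm r v,
        abs_of_nonneg (by linarith : 0 ≤ v - u), abs_of_nonneg (by linarith [hr.1] : 0 ≤ r - u),
        abs_of_nonneg (by linarith [hr.2] : 0 ≤ v - r)]
      ring
    have heq : ((γ r : ↥Λ) : X) = f (p + t • (q - p)) := by
      have := B.sq_dist_le hf (γ r).2 p q ht
      rw [hp, hq, ← Subtype.dist_eq, ← Subtype.dist_eq, dist_comm (γ r) (γ u), h1, h2] at this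
      rw [← dist_eq_zero, ← sq_eq_zero_iff]
      exact le_antisymm (by linarith) (sq_nonneg _)
    have h3 := B.sq_dist_le hf z.2 p q ht
    rw [← heq, hp, hq, ← Subtype.dist_eq, ← Subtype.dist_eq, ← Subtype.dist_eq, ← hl] at h3
    have h4 := sq_dist_segment x' y' z' t
    rw [hxy, hyz, hxz] at h4
    refine le_of_sq_le_sq ?_ dist_nonneg
    rw [h4, dist_comm (γ u) z, dist_comm (γ v) z]
    exact h3
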